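/- arXiv:2511.12641 — 8 statements merged into one kernel-verified Lean document; each statement's English description precedes it below -/
import Mathlib

section
/- Let P be an n×n pattern with term-rank n in standard form, with digraph D. Then every real matrix in Z(P) has all simple singular values (equivalently, every matrix in Z(P) has n distinct singular values) if and only if D is a weak path. -/
open Matrix Polynomial

/-- A pattern is a matrix each of whose entries is `0` or `1`. -/
def IsPattern {α β : Type*} (P : Matrix α β ℝ) : Prop :=
  ∀ i j, P i j = 0 ∨ P i j = 1

/-- `A` has pattern `P`: the entries of `A` are nonzero exactly where `P` has a `1`. -/
def HasPattern {α β : Type*} (A P : Matrix α β ℝ) : Prop :=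
  ∀ i j, A i j ≠ 0 ↔ P i j = 1

/-- The Strong Singular Value Property. -/
def SSVP {α β : Type*} [Fintype α] [Fintype β] (A : Matrix α β ℝ) : Prop :=
  ∀ X : Matrix α β ℝ,
    (Aᵀ * X).IsSymm → (X * Aᵀ).IsSymm → (∀ i j, A i j * X i j = 0) → X = 0

/-- The multiplicity of `σ` as a singular value of `A`: the algebraic multiplicity of `σ²`
as an eigenvalue (root of the characteristic polynomial) of `A * Aᵀ`. -/
noncomputable def singValMult {α β : Type*} [Fintype α] [DecidableEq α] [Fintype β]
    (A : Matrix α β ℝ) (σ : ℝ) : ℕ :=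
  (A * Aᵀ).charpoly.rootMultiplicity (σ ^ 2)

/-- The digraph of the `n × n` pattern `P` (in standard form) is a weak path: there is an
ordering `v 0, v 1, …, v (n-1)` of the vertices such that between consecutive vertices
exactly one of the two possible arcs is present, and there are no other arcs. -/
def IsWeakPath {n : ℕ} (P : Matrix (Fin n) (Fin n) ℝ) : Prop :=
  ∃ v : Fin n ≃ Fin n, ∀ a b : Fin n, a ≠ b →
    (((a : ℕ) + 1 = (b : ℕ) ∨ (b : ℕ) + 1 = (a : ℕ)) →
        Xor' (P (v a) (v b) = 1) (P (v b) (v a) = 1)) ∧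
    (¬((a : ℕ) + 1 = (b : ℕ) ∨ (b : ℕ) + 1 = (a : ℕ)) → P (v a) (v b) = 0)

section SingularValueMultiplicity

variable {α β : Type*} [Fintype α] [DecidableEq α] [Fintype β]

lemma two_le_singValMult {A : Matrix α β ℝ} {σ : ℝ} {u v : α → ℝ}
    (huv : LinearIndependent ℝ ![u, v])
    (hu : A *ᵥ (Aᵀ *ᵥ u) = σ ^ 2 • u) (hv : A *ᵥ (Aᵀ *ᵥ v) = σ ^ 2 • v) :
    2 ≤ singValMult A σ := by
  have h := LinearMap.finrank_eigenspace_le (Matrix.toLin' (A * Aᵀ)) (σ ^ 2)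
  rw [Matrix.charpoly_toLin'] at h
  refine le_trans ?_ h
  have hmem : ∀ i, ![u, v] i ∈ Module.End.eigenspace (Matrix.toLin' (A * Aᵀ)) (σ ^ 2) := by
    intro i
    rw [Module.End.mem_eigenspace_iff]
    rw [Matrix.toLin'_apply, ← Matrix.mulVec_mulVec]
    fin_cases i
    exacts [hu, hv]
  have hspan := finrank_span_eq_card huv
  rw [Fintype.card_fin] at hspan
  refine hspan.symm.le.trans ?_
  exact Submodule.finrank_mono (Submodule.span_le.2 (by rintro _ ⟨i, rfl⟩; exact hmem i))

lemma exists_eigenvector_apply_eq_zero {A : Matrix α β ℝ} {σ : ℝ} (h : 2 ≤ singValMult A σ)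
    (a : α) : ∃ u : α → ℝ, u ≠ 0 ∧ u a = 0 ∧ A *ᵥ (Aᵀ *ᵥ u) = σ ^ 2 • u := by
  have hA : (A * Aᵀ).IsHermitian := by
    simpa using Matrix.isHermitian_mul_conjTranspose_self A
  have hcount : 1 < (Finset.univ.filter fun i => σ ^ 2 = hA.eigenvalues i).card := by
    rw [singValMult, ← Polynomial.count_roots, hA.roots_charpoly_eq_eigenvalues,
      Multiset.count_map] at h
    exact h
  obtain ⟨i, hi, j, hj, hij⟩ := Finset.one_lt_card.1 hcount
  rw [Finset.mem_filter] at hi hj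
  set b := hA.eigenvectorBasis
  have hb : ∀ k, σ ^ 2 = hA.eigenvalues k → A *ᵥ (Aᵀ *ᵥ (b k).ofLp) = σ ^ 2 • (b k).ofLp := by
    intro k hk
    rw [Matrix.mulVec_mulVec, hA.mulVec_eigenvectorBasis k, hk]
  by_cases h0 : b i a = 0
  · exact ⟨b i, fun h => b.orthonormal.ne_zero i (by ext x; exact congrFun h x), h0, hb i hi.2⟩
  · refine ⟨(b j a) • (b i).ofLp - (b i a) • (b j).ofLp, fun h => h0 ?_, ?_, ?_⟩
    · have h' : (b j a) • b i - (b i a) • b j = 0 := by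
        ext x
        exact congrFun h x
      have h2 := congrArg (fun z => inner ℝ (b j) z) h'
      simpa [inner_sub_right, inner_smul_right, b.inner_eq_ite, hij.symm] using h2
    · simp [mul_comm]
    · simp only [Matrix.mulVec_sub, Matrix.mulVec_smul, hb i hi.2, hb j hj.2, smul_sub]
      rw [smul_comm (σ ^ 2), smul_comm (σ ^ 2)]

lemma singValMult_transpose (A : Matrix α α ℝ) (σ : ℝ) :
    singValMult Aᵀ σ = singValMult A σ := by
  rw [singValMult, singValMult, Matrix.transpose_transpose, Matrix.charpoly_mul_comm]

lemma singValMult_submatrix {γ : Type*} [Fintype γ] [DecidableEq γ] (A : Matrix α α ℝ)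
    (e : γ ≃ α) (σ : ℝ) : singValMult (A.submatrix e e) σ = singValMult A σ := by
  rw [singValMult, singValMult, Matrix.transpose_submatrix, Matrix.submatrix_mul_equiv]
  have := Matrix.charpoly_reindex e.symm (A * Aᵀ)
  rw [Matrix.reindex_apply] at this
  rw [← this]
  rfl

lemma singValMult_orthogonal_mul_mul {A U V : Matrix α α ℝ} (hU : Uᵀ * U = 1) (hV : V * Vᵀ = 1)
    (σ : ℝ) : singValMult (U * A * V) σ = singValMult A σ := by
  have h : U * A * V * (U * A * V)ᵀ = U * (A * Aᵀ * Uᵀ) := by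
    simp only [Matrix.transpose_mul, Matrix.mul_assoc]
    rw [← Matrix.mul_assoc V, hV, Matrix.one_mul]
  rw [singValMult, singValMult, h, Matrix.charpoly_mul_comm, Matrix.mul_assoc, hU, Matrix.mul_one]

end SingularValueMultiplicity

section Superpattern

open Filter Topology NormedSpace
open scoped Matrix.Norms.Operator

variable {α : Type*} [Fintype α]

/-- The linear map that keeps the entries of a matrix at the nonzero positions of `A`. -/
noncomputable def supportCLM (A : Matrix α α ℝ) : Matrix α α ℝ →L[ℝ] Matrix α α ℝ :=
  LinearMap.toContinuousLinearMap
    { toFun := fun B => Matrix.of fun i j => if A i j = 0 then 0 else B i j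
      map_add' := fun B C => by ext i j; by_cases h : A i j = 0 <;> simp [h]
      map_smul' := fun c B => by ext i j; by_cases h : A i j = 0 <;> simp [h] }

lemma supportCLM_apply (A B : Matrix α α ℝ) (i j : α) :
    supportCLM A B i j = if A i j = 0 then 0 else B i j := rfl

variable [DecidableEq α]

/-- The linear map sending a matrix to its skew-symmetric part (up to a factor). -/
noncomputable def skewCLM (α : Type*) [Fintype α] [DecidableEq α] :
    Matrix α α ℝ →L[ℝ] Matrix α α ℝ :=
  LinearMap.toContinuousLinearMap
    (LinearMap.id - (Matrix.transposeLinearEquiv α α ℝ ℝ).toLinearMap)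

lemma skewCLM_apply (K : Matrix α α ℝ) : skewCLM α K = K - Kᵀ := rfl

lemma exp_skewCLM_mul_transpose (K : Matrix α α ℝ) :
    exp (skewCLM α K) * (exp (skewCLM α K))ᵀ = 1 := by
  have h : (skewCLM α K)ᵀ = -skewCLM α K := by simp [skewCLM_apply]
  rw [← Matrix.exp_transpose, h,
    ← Matrix.exp_add_of_commute _ _ ((Commute.refl (skewCLM α K)).neg_right),
    add_neg_cancel, NormedSpace.exp_zero]

lemma exp_skewCLM_transpose_mul (K : Matrix α α ℝ) :
    (exp (skewCLM α K))ᵀ * exp (skewCLM α K) = 1 :=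
  mul_eq_one_comm.1 (exp_skewCLM_mul_transpose K)

/-- Rotating `A` on both sides and subtracting a matrix supported where `A` is nonzero. -/
noncomputable def rotateSub (A : Matrix α α ℝ)
    (p : Matrix α α ℝ × Matrix α α ℝ × Matrix α α ℝ) : Matrix α α ℝ :=
  exp (skewCLM α p.1) * A * exp (skewCLM α p.2.1) - supportCLM A p.2.2

/-- The derivative of `rotateSub A` at the origin. -/
noncomputable def rotateSubDeriv (A : Matrix α α ℝ) :
    Matrix α α ℝ × Matrix α α ℝ × Matrix α α ℝ →L[ℝ] Matrix α α ℝ :=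
  LinearMap.toContinuousLinearMap
    { toFun := fun p => skewCLM α p.1 * A + A * skewCLM α p.2.1 - supportCLM A p.2.2
      map_add' := fun p q => by simp [add_mul, mul_add]; abel
      map_smul' := fun c p => by simp [smul_sub] }

lemma rotateSubDeriv_apply (A : Matrix α α ℝ)
    (p : Matrix α α ℝ × Matrix α α ℝ × Matrix α α ℝ) :
    rotateSubDeriv A p = skewCLM α p.1 * A + A * skewCLM α p.2.1 - supportCLM A p.2.2 := rfl

lemma hasStrictFDerivAt_exp_skewCLM :
    HasStrictFDerivAt (fun K : Matrix α α ℝ => exp (skewCLM α K)) (skewCLM α) 0 := by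
  have h : HasStrictFDerivAt (exp : Matrix α α ℝ → Matrix α α ℝ)
      (1 : Matrix α α ℝ →L[ℝ] Matrix α α ℝ) (skewCLM α 0) := by
    rw [map_zero]
    exact hasStrictFDerivAt_exp_zero
  exact h.comp 0 (skewCLM α).hasStrictFDerivAt

lemma hasStrictFDerivAt_rotateSub (A : Matrix α α ℝ) :
    HasStrictFDerivAt (rotateSub A) (rotateSubDeriv A) 0 := by
  have h1 := HasStrictFDerivAt.comp (0 : Matrix α α ℝ × Matrix α α ℝ × Matrix α α ℝ)
    (f := Prod.fst) hasStrictFDerivAt_exp_skewCLM hasStrictFDerivAt_fst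
  have h2 := HasStrictFDerivAt.comp (0 : Matrix α α ℝ × Matrix α α ℝ × Matrix α α ℝ)
    (f := fun p => p.2.1) hasStrictFDerivAt_exp_skewCLM hasStrictFDerivAt_snd.fst
  have h3 := HasStrictFDerivAt.comp (0 : Matrix α α ℝ × Matrix α α ℝ × Matrix α α ℝ)
    (f := fun p => p.2.2) (supportCLM A).hasStrictFDerivAt hasStrictFDerivAt_snd.snd
  refine (((h1.mul_const' A).mul' h2).sub h3).congr_fderiv ?_
  refine ContinuousLinearMap.ext fun p => ?_
  simp
  exact congrArg (· - supportCLM A p.2.2) (add_comm _ _)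

lemma rotateSubDeriv_range {A : Matrix α α ℝ} (hA : SSVP A) : (rotateSubDeriv A).range = ⊤ := by
  by_contra hne
  obtain ⟨f, hf0, hf⟩ := Submodule.exists_le_ker_of_lt_top _ (lt_top_iff_ne_top.2 hne)
  set X : Matrix α α ℝ := Matrix.of fun i j => f (Matrix.single i j 1) with hX
  have hfX : ∀ M : Matrix α α ℝ, f M = (Xᵀ * M).trace := by
    intro M
    conv_lhs => rw [Matrix.matrix_eq_sum_single M]
    simp only [map_sum, Matrix.trace, Matrix.diag, Matrix.mul_apply]
    rw [Finset.sum_comm]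
    refine Finset.sum_congr rfl fun j _ => Finset.sum_congr rfl fun i _ => ?_
    rw [show Matrix.single i j (M i j) = M i j • Matrix.single i j (1 : ℝ) by simp]
    rw [map_smul]
    simp [hX, mul_comm]
  have hker : ∀ p, (Xᵀ * rotateSubDeriv A p).trace = 0 := fun p => by
    rw [← hfX]
    exact hf ⟨p, rfl⟩
  have hzero : X = 0 := by
    apply hA
    · ext i j
      have := hker (0, Matrix.single i j 1, 0)
      rw [rotateSubDeriv_apply] at this
      simp [skewCLM_apply, mul_sub, ← Matrix.mul_assoc, Matrix.trace_mul_single] at this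
      simp [Matrix.mul_apply] at this ⊢
      simp [mul_comm] at this ⊢
      linarith
    · ext i j
      have := hker (Matrix.single i j 1, 0, 0)
      rw [rotateSubDeriv_apply] at this
      simp only [skewCLM_apply, map_zero, mul_zero, add_zero, sub_zero] at this
      rw [Matrix.trace_mul_comm, Matrix.mul_assoc, Matrix.trace_mul_comm] at this
      simp [mul_sub, Matrix.trace_mul_single] at this
      simp [Matrix.mul_apply] at this ⊢
      simp [mul_comm] at this ⊢
      linarith
    · intro i j
      have := hker (0, 0, Matrix.single i j 1)
      rw [rotateSubDeriv_apply] at this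
      by_cases h : A i j = 0
      · simp [h]
      have hs : supportCLM A (Matrix.single i j 1) = Matrix.single i j 1 := by
        ext k l
        rw [supportCLM_apply]
        by_cases hkl : A k l = 0
        · rw [if_pos hkl, Matrix.single_apply, if_neg]
          rintro ⟨rfl, rfl⟩
          exact h hkl
        · rw [if_neg hkl]
      simp [hs, Matrix.trace_mul_single] at this
      rw [this, mul_zero]
  exact hf0 (LinearMap.ext fun M => by simp [hfX, hzero])

/-- **Superpattern theorem**: the singular value multiplicities of a matrix with the SSVP are attained
in every larger pattern. -/
theorem SSVP.exists_hasPattern {A P : Matrix α α ℝ} (hA : SSVP A)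
    (hAP : ∀ i j, A i j ≠ 0 → P i j = 1) :
    ∃ B : Matrix α α ℝ, HasPattern B P ∧ ∀ σ, singValMult B σ = singValMult A σ := by
  have hmap := (hasStrictFDerivAt_rotateSub A).map_nhds_eq_of_surj (rotateSubDeriv_range hA)
  have h0 : rotateSub A 0 = A := by simp [rotateSub]
  rw [h0] at hmap
  set E : Matrix α α ℝ := Matrix.of fun i j => if A i j = 0 ∧ P i j = 1 then 1 else 0 with hE
  have hU : ∀ᶠ p : Matrix α α ℝ × Matrix α α ℝ × Matrix α α ℝ in 𝓝 0,
      ∀ i j, A i j ≠ 0 → A i j + p.2.2 i j ≠ 0 := by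
    rw [eventually_all]
    intro i
    rw [eventually_all]
    intro j
    by_cases h : A i j = 0
    · simp [h]
    · have hc : Continuous fun p : Matrix α α ℝ × Matrix α α ℝ × Matrix α α ℝ =>
          A i j + p.2.2 i j := by fun_prop
      have := hc.continuousAt.eventually_ne (x := 0) (y := 0) (by simpa using h)
      filter_upwards [this] with p hp _ using hp
  have himg : rotateSub A '' {p | ∀ i j, A i j ≠ 0 → A i j + p.2.2 i j ≠ 0} ∈ 𝓝 A :=
    hmap.ge (image_mem_map hU)
  have hlim : Tendsto (fun t : ℝ => A + t • E) (𝓝[≠] 0) (𝓝 A) := by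
    have hc : Continuous fun t : ℝ => A + t • E := by fun_prop
    have := hc.tendsto 0
    simp only [zero_smul, add_zero] at this
    exact this.mono_left nhdsWithin_le_nhds
  obtain ⟨t, ⟨p, hp, hpt⟩, ht⟩ := ((hlim.eventually himg).and self_mem_nhdsWithin).exists
  refine ⟨exp (skewCLM α p.1) * A * exp (skewCLM α p.2.1), ?_, fun σ =>
    singValMult_orthogonal_mul_mul (exp_skewCLM_transpose_mul _) (exp_skewCLM_mul_transpose _) σ⟩
  have hB : exp (skewCLM α p.1) * A * exp (skewCLM α p.2.1) = A + t • E + supportCLM A p.2.2 :=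
    sub_eq_iff_eq_add.1 hpt
  intro i j
  rw [hB]
  have ht0 : t ≠ 0 := ht
  by_cases h : A i j = 0
  · simp [supportCLM_apply, h, hE, ht0]
  · simpa [supportCLM_apply, h, hE, hAP i j h] using hp i j h

end Superpattern

section Embedding

variable {α β : Type*} [Fintype α] [Fintype β]

lemma exists_diagonal_avoiding (p : ℝ[X]) (hp : p ≠ 0) :
    ∃ d : β → ℝ, (∀ b, 0 < d b) ∧ Function.Injective d ∧ ∀ b, ¬ p.IsRoot (d b ^ 2) := by
  obtain ⟨C, hC⟩ := p.roots.toFinset.exists_le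
  refine ⟨fun b => |C| + 1 + (Fintype.equivFin β b : ℕ), fun b => by positivity,
    fun b c hbc => by simpa [Fin.val_inj] using hbc, fun b hb => ?_⟩
  have h := hC _ (by simpa [hp] using hb)
  have h1 := le_abs_self C
  have h2 := abs_nonneg C
  have h3 : (0 : ℝ) ≤ (Fintype.equivFin β b : ℕ) := Nat.cast_nonneg _
  nlinarith

lemma SSVP.submatrix_equiv {A : Matrix α α ℝ} (hA : SSVP A) (e : β ≃ α) :
    SSVP (A.submatrix e e) := by
  intro X h1 h2 h3
  have key := hA (X.submatrix e.symm e.symm) ?_ ?_ ?_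
  · ext i j
    simpa using congrFun (congrFun key (e i)) (e j)
  · have := h1.submatrix e.symm
    rw [← Matrix.submatrix_mul_equiv _ _ _ e.symm] at this
    simpa [Matrix.transpose_submatrix] using this
  · have := h2.submatrix e.symm
    rw [← Matrix.submatrix_mul_equiv _ _ _ e.symm] at this
    simpa [Matrix.transpose_submatrix] using this
  · intro i j
    simpa using h3 (e.symm i) (e.symm j)

variable [DecidableEq α] [DecidableEq β]

lemma SSVP.fromBlocks_diagonal {A : Matrix α α ℝ} (hA : SSVP A) {d : β → ℝ} (hd : ∀ b, 0 < d b)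
    (hinj : Function.Injective d) (hroot : ∀ b, ¬ (A * Aᵀ).charpoly.IsRoot (d b ^ 2)) :
    SSVP (Matrix.fromBlocks A 0 0 (Matrix.diagonal d)) := by
  intro X h1 h2 h3
  obtain ⟨W, Y, Z, V, rfl⟩ : ∃ W Y Z V, X = Matrix.fromBlocks W Y Z V :=
    ⟨_, _, _, _, (Matrix.fromBlocks_toBlocks X).symm⟩
  rw [Matrix.fromBlocks_transpose, Matrix.fromBlocks_multiply, Matrix.isSymm_fromBlocks_iff] at h1 h2
  simp only [Matrix.transpose_zero, Matrix.zero_mul, Matrix.mul_zero, add_zero, zero_add,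
    Matrix.diagonal_transpose, Matrix.transpose_mul, Matrix.transpose_transpose] at h1 h2
  obtain ⟨hW1, hYZ1, -, hV1⟩ := h1
  obtain ⟨hW2, hYZ2, -, hV2⟩ := h2
  have hW : W = 0 := hA W hW1 hW2 fun i j => by simpa using h3 (Sum.inl i) (Sum.inl j)
  have hY : Y = 0 := by
    have hYA : A * Aᵀ * Y = Y * (Matrix.diagonal d * Matrix.diagonal d) := by
      apply Matrix.transpose_injective
      simp only [Matrix.transpose_mul, Matrix.transpose_transpose, Matrix.diagonal_transpose]
      rw [Matrix.mul_assoc, hYZ2, ← Matrix.mul_assoc, hYZ1, Matrix.mul_assoc]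
    ext a b
    have hdet : (Matrix.scalar α (d b ^ 2) - A * Aᵀ).det ≠ 0 := by
      rw [← Matrix.eval_charpoly]
      exact hroot b
    refine congrFun (Matrix.eq_zero_of_mulVec_eq_zero hdet (v := fun a => Y a b) ?_) a
    ext i
    have := congrFun (congrFun hYA i) b
    rw [Matrix.diagonal_mul_diagonal, Matrix.mul_diagonal, Matrix.mul_apply] at this
    rw [Matrix.sub_mulVec, Pi.sub_apply, Matrix.mulVec, dotProduct, Matrix.mulVec, dotProduct, this]
    simp [Matrix.diagonal_apply]
    ring
  have hZ : Z = 0 := by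
    rw [hY] at hYZ1
    ext b a
    have := congrFun (congrFun hYZ1 b) a
    simpa [Matrix.diagonal_mul, (hd b).ne'] using this
  have hV : V = 0 := by
    ext b c
    have e1 := congrFun (congrFun hV1 b) c
    have e2 := congrFun (congrFun hV2 b) c
    simp only [Matrix.transpose_apply, Matrix.diagonal_mul, Matrix.mul_diagonal] at e1 e2
    by_cases hbc : b = c
    · subst hbc
      simpa [(hd b).ne'] using h3 (Sum.inr b) (Sum.inr b)
    · have hne : d b * d b - d c * d c ≠ 0 := by
        intro h
        exact hbc (hinj ((mul_self_inj (hd b).le (hd c).le).1 (sub_eq_zero.1 h)))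
      refine (mul_eq_zero.1 (?_ : (d b * d b - d c * d c) * V b c = 0)).resolve_left hne
      linear_combination -d b * e1 + d c * e2
  rw [hW, hY, hZ, hV, Matrix.fromBlocks_zero]

lemma singValMult_fromBlocks_ge (A : Matrix α α ℝ) (D : Matrix β β ℝ) (σ : ℝ) :
    singValMult A σ ≤ singValMult (Matrix.fromBlocks A 0 0 D) σ := by
  rw [singValMult, singValMult, Matrix.fromBlocks_transpose, Matrix.fromBlocks_multiply]
  simp only [Matrix.transpose_zero, Matrix.zero_mul, Matrix.mul_zero, add_zero, zero_add]
  rw [Matrix.charpoly_fromBlocks_zero₁₂, Polynomial.rootMultiplicity_mul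
    (mul_ne_zero (Matrix.charpoly_monic _).ne_zero (Matrix.charpoly_monic _).ne_zero)]
  exact Nat.le_add_right _ _

/-- A matrix with the SSVP that embeds into a pattern with full diagonal passes its singular value
multiplicities on to some matrix with that pattern. -/
theorem SSVP.exists_hasPattern_of_injective {P : Matrix β β ℝ} (hdiag : ∀ i, P i i = 1)
    {A : Matrix α α ℝ} (hA : SSVP A) {g : α → β} (hg : Function.Injective g)
    (hAP : ∀ i j, A i j ≠ 0 → P (g i) (g j) = 1) :
    ∃ B : Matrix β β ℝ, HasPattern B P ∧ ∀ σ, singValMult A σ ≤ singValMult B σ := by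
  classical
  let e : β ≃ α ⊕ ((Set.range g)ᶜ : Set β) :=
    ((Equiv.ofInjective g hg).sumCongr (Equiv.refl _)).trans
      (Equiv.Set.sumCompl (Set.range g)) |>.symm
  have hinl : ∀ a, e.symm (Sum.inl a) = g a := fun a => by simp [e]
  obtain ⟨d, hd, hinj, hroot⟩ := exists_diagonal_avoiding (β := ((Set.range g)ᶜ : Set β))
    (A * Aᵀ).charpoly (Matrix.charpoly_monic _).ne_zero
  obtain ⟨B, hB, hBA⟩ :=
    ((hA.fromBlocks_diagonal hd hinj hroot).submatrix_equiv e).exists_hasPattern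
    (P := P) (by
      intro i j hij
      obtain ⟨i, rfl⟩ := e.symm.surjective i
      obtain ⟨j, rfl⟩ := e.symm.surjective j
      rw [Matrix.submatrix_apply, Equiv.apply_symm_apply, Equiv.apply_symm_apply] at hij
      rcases i with i | i <;> rcases j with j | j
      · rw [hinl, hinl]
        exact hAP i j hij
      · simp at hij
      · simp at hij
      · by_cases h : i = j
        · rw [h, hdiag]
        · simp [h] at hij)
  refine ⟨B, hB, fun σ => ?_⟩
  rw [hBA, singValMult_submatrix]
  exact singValMult_fromBlocks_ge A _ σ

end Embedding

section ForbiddenConfigurations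

lemma ssvp_rotation : SSVP !![(1 : ℝ), 1; -1, 1] := by
  intro X _ _ h
  ext i j
  have := h i j
  fin_cases i <;> fin_cases j <;> simpa using this

lemma two_le_singValMult_rotation : 2 ≤ singValMult !![(1 : ℝ), 1; -1, 1] √2 := by
  refine two_le_singValMult (u := ![1, 0]) (v := ![0, 1]) ?_ ?_ ?_
  · rw [LinearIndependent.pair_iff]
    intro s t h
    exact ⟨by simpa using congrFun h 0, by simpa using congrFun h 1⟩
  all_goals
    ext i
    fin_cases i <;> simp [Matrix.mulVec, dotProduct, Fin.sum_univ_succ] <;> norm_num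

lemma ssvp_star_out : SSVP !![(1 : ℝ), 1, 1, 1; 0, 1, 0, 0; 0, 0, 1, 0; 0, 0, 0, 1] := by
  intro X h1 h2 h
  have e := fun i j => h i j
  have f1 := fun i j => congrFun (congrFun h1 i) j
  have f2 := fun i j => congrFun (congrFun h2 i) j
  simp [Fin.forall_fin_succ, Matrix.mul_apply, Fin.sum_univ_succ] at e f1 f2
  ext i j
  fin_cases i <;> fin_cases j <;> simp <;> linarith

lemma two_le_singValMult_star_out :
    2 ≤ singValMult !![(1 : ℝ), 1, 1, 1; 0, 1, 0, 0; 0, 0, 1, 0; 0, 0, 0, 1] 1 := by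
  refine two_le_singValMult (u := ![0, 1, -1, 0]) (v := ![0, 0, -1, 1]) ?_ ?_ ?_
  · rw [LinearIndependent.pair_iff]
    intro s t h
    exact ⟨by simpa using congrFun h 1, by simpa using congrFun h 3⟩
  all_goals
    ext i
    fin_cases i <;> simp [Matrix.mulVec, dotProduct, Fin.sum_univ_succ]

lemma ssvp_star_mixed : SSVP !![(1 : ℝ), 1, 1, 0; 0, 5, 0, 0; 0, 0, 5, 0; 3, 0, 0, 4] := by
  intro X h1 h2 h
  have e := fun i j => h i j
  have f1 := fun i j => congrFun (congrFun h1 i) j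
  have f2 := fun i j => congrFun (congrFun h2 i) j
  simp [Fin.forall_fin_succ, Matrix.mul_apply, Fin.sum_univ_succ] at e f1 f2
  ext i j
  fin_cases i <;> fin_cases j <;> simp <;> linarith

lemma two_le_singValMult_star_mixed :
    2 ≤ singValMult !![(1 : ℝ), 1, 1, 0; 0, 5, 0, 0; 0, 0, 5, 0; 3, 0, 0, 4] 5 := by
  refine two_le_singValMult (u := ![0, 1, -1, 0]) (v := ![0, -3 / 5, 0, 1]) ?_ ?_ ?_
  · rw [LinearIndependent.pair_iff]
    intro s t h
    have h3 : t = 0 := by simpa using congrFun h 3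
    exact ⟨by simpa [h3] using congrFun h 1, h3⟩
  all_goals
    ext i
    fin_cases i <;> simp [Matrix.mulVec, dotProduct, Fin.sum_univ_succ] <;> norm_num

end ForbiddenConfigurations

section Disconnected

variable {α : Type*} [Fintype α]

/-- A closed nonempty set of vertices carries an eigenvector of `P * Pᵀ` with positive eigenvalue. -/
lemma exists_eigenvector_supported {P : Matrix α α ℝ} (hdiag : ∀ i, P i i = 1) {S : Set α}
    (hS : S.Nonempty) (hclosed : ∀ i ∈ S, ∀ j ∉ S, P i j = 0 ∧ P j i = 0) :
    ∃ (u : α → ℝ) (t : ℝ), u ≠ 0 ∧ 0 < t ∧ (∀ i ∉ S, u i = 0) ∧ P *ᵥ (Pᵀ *ᵥ u) = t • u := by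
  classical
  set M : Matrix α α ℝ := Matrix.of fun i j => if i ∈ S then P i j else 0 with hM
  have hMH : (M * Mᵀ).IsHermitian := by simpa using Matrix.isHermitian_mul_conjTranspose_self M
  have hM0 : M * Mᵀ ≠ 0 := by
    obtain ⟨s, hs⟩ := hS
    intro h
    have h1 := congrFun (congrFun h s) s
    simp only [Matrix.mul_apply, Matrix.transpose_apply, Matrix.zero_apply] at h1
    rw [Finset.sum_eq_zero_iff_of_nonneg (fun j _ => mul_self_nonneg (M s j))] at h1
    simpa [hM, hs, hdiag] using h1 s (Finset.mem_univ s)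
  obtain ⟨u, t, ht, hu, hut⟩ := hMH.exists_eigenvector_of_ne_zero hM0
  have hsupp : ∀ i ∉ S, u i = 0 := by
    intro i hi
    have h1 := congrFun hut i
    rw [← Matrix.mulVec_mulVec] at h1
    have h2 : (M *ᵥ (Mᵀ *ᵥ u)) i = 0 := by simp [Matrix.mulVec, dotProduct, hM, hi]
    rw [h2] at h1
    simpa [ht] using h1.symm
  have htpos : 0 < t := by
    have h1 : (Mᵀ *ᵥ u) ⬝ᵥ (Mᵀ *ᵥ u) = t * (u ⬝ᵥ u) := by
      rw [Matrix.dotProduct_mulVec, Matrix.vecMul_transpose, Matrix.mulVec_mulVec, hut,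
        smul_dotProduct, smul_eq_mul]
    have h2 : 0 ≤ (Mᵀ *ᵥ u) ⬝ᵥ (Mᵀ *ᵥ u) := Finset.sum_nonneg fun i _ => mul_self_nonneg _
    have h3 : 0 < u ⬝ᵥ u := lt_of_le_of_ne (Finset.sum_nonneg fun i _ => mul_self_nonneg _)
      fun h => hu (dotProduct_self_eq_zero.1 h.symm)
    exact lt_of_le_of_ne (nonneg_of_mul_nonneg_left (h1 ▸ h2) h3) ht.symm
  refine ⟨u, t, hu, htpos, hsupp, ?_⟩
  have hPM : Pᵀ *ᵥ u = Mᵀ *ᵥ u := by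
    ext j
    refine Finset.sum_congr rfl fun i _ => ?_
    by_cases hi : i ∈ S
    · simp [hM, hi]
    · simp [hsupp i hi]
  rw [← hut, ← Matrix.mulVec_mulVec, hPM]
  ext i
  refine Finset.sum_congr rfl fun j _ => ?_
  by_cases hi : i ∈ S
  · simp [hM, hi]
  · by_cases hj : j ∈ S
    · simp [hM, hi, (hclosed j hj i hi).2]
    · have : (Mᵀ *ᵥ u) j = 0 := by
        refine Finset.sum_eq_zero fun k _ => ?_
        by_cases hk : k ∈ S
        · simp [hM, hk, (hclosed k hk j hj).1]
        · simp [hM, hk]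
      rw [this, mul_zero, mul_zero]

variable [DecidableEq α]

lemma mulVec_scaled_eigenvector {P : Matrix α α ℝ} {c u : α → ℝ} {t : ℝ} (ht : 0 < t)
    (hc : ∀ i, u i ≠ 0 → c i = (√t)⁻¹) (hu : P *ᵥ (Pᵀ *ᵥ u) = t • u) :
    (Matrix.diagonal c * P) *ᵥ ((Matrix.diagonal c * P)ᵀ *ᵥ u) = u := by
  have hcu : Matrix.diagonal c *ᵥ u = (√t)⁻¹ • u := by
    ext i
    rw [Matrix.mulVec_diagonal, Pi.smul_apply, smul_eq_mul]
    by_cases h : u i = 0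
    · simp [h]
    · rw [hc i h]
  rw [Matrix.transpose_mul, Matrix.diagonal_transpose, ← Matrix.mulVec_mulVec u, hcu,
    ← Matrix.mulVec_mulVec, Matrix.mulVec_smul, Matrix.mulVec_smul, hu, smul_smul,
    Matrix.mulVec_smul, hcu, smul_smul]
  have h1 : √t ≠ 0 := (Real.sqrt_pos.2 ht).ne'
  have h2 : (√t)⁻¹ * t * (√t)⁻¹ = 1 := by
    field_simp
    exact (Real.sq_sqrt ht.le).symm
  rw [h2, one_smul]

theorem exists_hasPattern_of_disconnected {P : Matrix α α ℝ} (hP : IsPattern P)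
    (hdiag : ∀ i, P i i = 1) {S : Set α} (hS : S.Nonempty) (hSc : Sᶜ.Nonempty)
    (hclosed : ∀ i ∈ S, ∀ j ∉ S, P i j = 0 ∧ P j i = 0) :
    ∃ A : Matrix α α ℝ, HasPattern A P ∧ 2 ≤ singValMult A 1 := by
  classical
  obtain ⟨u, t, hu0, ht, hu, hut⟩ := exists_eigenvector_supported hdiag hS hclosed
  obtain ⟨v, r, hv0, hr, hv, hvr⟩ := exists_eigenvector_supported hdiag hSc
    (fun i hi j hj => (hclosed j (not_not.1 hj) i hi).symm)
  set c : α → ℝ := fun i => if i ∈ S then (√t)⁻¹ else (√r)⁻¹ with hc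
  have hcne : ∀ i, c i ≠ 0 := by
    intro i
    by_cases hi : i ∈ S
    · simp [hc, hi, (Real.sqrt_pos.2 ht).ne']
    · simp [hc, hi, (Real.sqrt_pos.2 hr).ne']
  have hcu : ∀ i, u i ≠ 0 → c i = (√t)⁻¹ := fun i hi =>
    if_pos (by_contra fun h => hi (hu i h))
  have hcv : ∀ i, v i ≠ 0 → c i = (√r)⁻¹ := fun i hi =>
    if_neg fun h => hi (hv i (not_not.2 h))
  refine ⟨Matrix.diagonal c * P, fun i j => ?_, two_le_singValMult (u := u) (v := v) ?_ ?_ ?_⟩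
  · rw [Matrix.diagonal_mul]
    rcases hP i j with h | h <;> simp [h, hcne i]
  · rw [LinearIndependent.pair_iff]
    intro a b hab
    obtain ⟨i, hi⟩ := Function.ne_iff.1 hu0
    obtain ⟨j, hj⟩ := Function.ne_iff.1 hv0
    have hiS : i ∈ S := by_contra fun h => hi (hu i h)
    have hjS : j ∉ S := fun h => hj (hv j (not_not.2 h))
    have h1 := congrFun hab i
    have h2 := congrFun hab j
    simp only [Pi.add_apply, Pi.smul_apply, smul_eq_mul, hv i (not_not.2 hiS), hu j hjS,
      mul_zero, add_zero, zero_add, Pi.zero_apply, mul_eq_zero] at h1 h2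
    exact ⟨h1.resolve_right hi, h2.resolve_right hj⟩
  · rw [one_pow, one_smul, mulVec_scaled_eigenvector ht hcu hut]
  · rw [one_pow, one_smul, mulVec_scaled_eigenvector hr hcv hvr]

end Disconnected

section WeakPath

variable {n : ℕ} {A : Matrix (Fin n) (Fin n) ℝ}

/-- The digraph of the nonzero entries of `A` is a weak path in the natural order. -/
structure IsWeakPathMatrix (A : Matrix (Fin n) (Fin n) ℝ) : Prop where
  diag : ∀ i, A i i ≠ 0
  consecutive : ∀ i j : Fin n, (i : ℕ) + 1 = j → Xor (A i j ≠ 0) (A j i ≠ 0)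
  other : ∀ i j : Fin n, i ≠ j → (i : ℕ) + 1 ≠ j → (j : ℕ) + 1 ≠ i → A i j = 0

lemma IsWeakPathMatrix.perm_eq_one (hA : IsWeakPathMatrix A) {π : Equiv.Perm (Fin n)}
    (hπ : ∀ i, A (π i) i ≠ 0) : π = 1 := by
  have hadj : ∀ i, π i ≠ i → (π i : ℕ) + 1 = i ∨ (i : ℕ) + 1 = π i := by
    intro i hi
    by_contra! h
    exact hπ i (hA.other _ _ hi h.1 h.2)
  ext1 i
  rw [Equiv.Perm.one_apply]
  induction i using WellFoundedLT.induction with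
  | _ i ih =>
  by_contra hi
  have hgt : i < π i := by
    refine lt_of_le_of_ne (not_lt.1 fun h => hi (π.injective (ih _ h))) (Ne.symm hi)
  obtain ⟨k, hk⟩ := π.surjective i
  have hki : π k ≠ k := by
    intro h
    rw [h] at hk
    exact hi (hk ▸ h)
  have hik : i ≤ k := not_lt.1 fun h => hki (ih k h)
  have h1 := hadj i hi
  have h2 := hadj k hki
  rw [hk] at h2
  rw [Fin.lt_def] at hgt
  rw [Fin.le_def] at hik
  have hkπ : π i = k := Fin.ext (by omega)
  have h3 := hπ i
  have h4 := hπ k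
  rw [hk] at h4
  rw [hkπ] at h3
  rcases hA.consecutive i k (by omega) with h | h
  · exact h.2 h3
  · exact h.2 h4

lemma IsWeakPathMatrix.det_ne_zero (hA : IsWeakPathMatrix A) : A.det ≠ 0 := by
  rw [Matrix.det_apply, Finset.sum_eq_single 1]
  · simpa [Finset.prod_eq_zero_iff] using hA.diag
  · intro π _ hπ
    obtain ⟨i, hi⟩ : ∃ i, A (π i) i = 0 := by
      by_contra! h
      exact hπ (hA.perm_eq_one h)
    have hprod : ∏ j, A (π j) j = 0 := Finset.prod_eq_zero (Finset.mem_univ i) hi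
    rw [hprod, smul_zero]
  · simp

lemma sum_mul_eq_single_of_lt_of_gt {a w : Fin n → ℝ} {i : Fin n} (hw : ∀ j < i, w j = 0)
    (ha : ∀ j > i, a j = 0) : ∑ j, a j * w j = a i * w i := by
  refine Finset.sum_eq_single i (fun j _ hj => ?_) (by simp)
  rcases lt_or_gt_of_ne hj with h | h
  · rw [hw j h, mul_zero]
  · rw [ha j h, zero_mul]

lemma IsWeakPathMatrix.eq_zero_of_mulVec (hA : IsWeakPathMatrix A) {σ : ℝ} (hσ : σ ≠ 0)
    {u v : Fin n → ℝ} (huv : A *ᵥ v = σ • u) (hvu : Aᵀ *ᵥ u = σ • v)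
    (h0 : ∀ i : Fin n, (i : ℕ) = 0 → u i = 0) (i : Fin n) : u i = 0 ∧ v i = 0 := by
  have hrow : ∀ k, ∑ j, A k j * v j = σ * u k := fun k => congrFun huv k
  have hcol : ∀ k, ∑ j, A j k * u j = σ * v k := fun k => congrFun hvu k
  induction i using WellFoundedLT.induction with
  | _ i ih =>
  have hu : ∀ j < i, u j = 0 := fun j hj => (ih j hj).1
  have hv : ∀ j < i, v j = 0 := fun j hj => (ih j hj).2
  have hfar : ∀ p j : Fin n, p < j → (p : ℕ) + 1 ≠ j → A p j = 0 ∧ A j p = 0 := by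
    intro p j hpj hne
    rw [Fin.lt_def] at hpj
    exact ⟨hA.other p j (by rw [Ne, Fin.ext_iff]; omega) hne (by omega),
      hA.other j p (by rw [Ne, Fin.ext_iff]; omega) (by omega) hne⟩
  have hor : u i = 0 ∨ v i = 0 := by
    rcases Nat.eq_zero_or_pos (i : ℕ) with hi | hi
    · exact Or.inl (h0 i hi)
    obtain ⟨p, hp⟩ : ∃ p : Fin n, (p : ℕ) + 1 = i := ⟨⟨i - 1, by omega⟩, by simp; omega⟩
    have hpi : p < i := by rw [Fin.lt_def]; omega
    have hgt : ∀ j > i, A p j = 0 ∧ A j p = 0 := fun j hj => by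
      rw [gt_iff_lt, Fin.lt_def] at hj
      exact hfar p j (by rw [Fin.lt_def]; omega) (by omega)
    rcases (hA.consecutive p i hp).or with h | h
    · right
      have := hrow p
      rw [sum_mul_eq_single_of_lt_of_gt hv fun j hj => (hgt j hj).1, hu p hpi, mul_zero] at this
      exact (mul_eq_zero.1 this).resolve_left h
    · left
      have := hcol p
      rw [sum_mul_eq_single_of_lt_of_gt hu fun j hj => (hgt j hj).2, hv p hpi, mul_zero] at this
      exact (mul_eq_zero.1 this).resolve_left h
  have hrel : A i i * v i = σ * u i ∨ A i i * u i = σ * v i := by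
    by_cases h : ∀ j > i, A i j = 0
    · left
      rw [← hrow i, sum_mul_eq_single_of_lt_of_gt hv h]
    · right
      push Not at h
      obtain ⟨j, hj, hij⟩ := h
      have hj1 : (i : ℕ) + 1 = j := by
        by_contra hne
        exact hij (hfar i j hj hne).1
      rw [← hcol i, sum_mul_eq_single_of_lt_of_gt hu]
      intro k hk
      by_cases hk1 : (i : ℕ) + 1 = k
      · obtain rfl : k = j := Fin.ext (by omega)
        rcases hA.consecutive i k hj1 with h | h
        · exact not_not.1 h.2
        · exact absurd hij h.2
      · exact (hfar i k hk hk1).2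
  have hd := hA.diag i
  rcases hor with h | h <;> rcases hrel with h' | h' <;> simp_all

lemma IsWeakPathMatrix.singValMult_le_one (hA : IsWeakPathMatrix A) (σ : ℝ) :
    singValMult A σ ≤ 1 := by
  by_contra! hlt
  rcases Nat.eq_zero_or_pos n with rfl | hn
  · simp only [singValMult, Matrix.charpoly, Matrix.det_isEmpty] at hlt
    rw [Polynomial.rootMultiplicity_eq_zero (by simp)] at hlt
    exact absurd hlt (by norm_num)
  obtain ⟨u, hu0, hu, hAu⟩ := exists_eigenvector_apply_eq_zero (Nat.succ_le_of_lt hlt) ⟨0, hn⟩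
  rcases eq_or_ne σ 0 with rfl | hσ
  · refine hu0 (Matrix.eq_zero_of_mulVec_eq_zero (M := A * Aᵀ) ?_ ?_)
    · rw [Matrix.det_mul, Matrix.det_transpose]
      exact mul_ne_zero hA.det_ne_zero hA.det_ne_zero
    · rw [← Matrix.mulVec_mulVec, hAu]
      simp
  · refine hu0 (funext fun i => (hA.eq_zero_of_mulVec hσ (u := u) (v := σ⁻¹ • Aᵀ *ᵥ u) ?_ ?_ ?_ i).1)
    · rw [Matrix.mulVec_smul, hAu, smul_smul]
      congr 1
      field_simp
    · rw [smul_smul, mul_inv_cancel₀ hσ, one_smul]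
    · intro i hi
      rw [← hu]
      congr 1
      exact Fin.ext hi

end WeakPath

theorem IsWeakPath.singValMult_le_one {n : ℕ} {P A : Matrix (Fin n) (Fin n) ℝ}
    (hdiag : ∀ i, P i i = 1) (hP : IsWeakPath P) (hA : HasPattern A P) (σ : ℝ) :
    singValMult A σ ≤ 1 := by
  obtain ⟨v, hv⟩ := hP
  rw [← singValMult_submatrix A v]
  refine IsWeakPathMatrix.singValMult_le_one (A := A.submatrix v v)
    ⟨fun i => (hA _ _).2 (hdiag _), fun i j hij => ?_, fun i j hne h1 h2 => ?_⟩ σ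
  · have hne : i ≠ j := by
      rintro rfl
      omega
    have := (hv i j hne).1 (Or.inl hij)
    simp only [Matrix.submatrix_apply]
    rw [hA, hA]
    exact this
  · by_contra h
    have h3 := (hA _ _).1 h
    rw [(hv i j hne).2 (by tauto)] at h3
    exact zero_ne_one h3

section Cycle

variable {m : ℕ}

/-- A matrix whose digraph is a cycle `0, 1, …, m + 2`, with the edge between `i` and `i + 1`
directed forward exactly when `f i`. -/
def cycleMatrix (f : Fin (m + 3) → Bool) (a w : Fin (m + 3) → ℝ) :
    Matrix (Fin (m + 3)) (Fin (m + 3)) ℝ :=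
  Matrix.of fun i j => (if j = i then a i else 0)
    + (if j = i + 1 then (if f i then w i else 0) else 0)
    + (if j = i - 1 then (if f j then 0 else w j) else 0)

/-- The vector on the rows of a cycle matrix determined by the vectors `l` and `r` that it shows to
the preceding and the following vertex. -/
def cycleVec (f : Fin (m + 3) → Bool) (a l r : Fin (m + 3) → ℝ) : Fin (m + 3) → ℝ :=
  fun i => if f i then r i else if f (i - 1) then a i * l i else l i

lemma fin_add_one_ne (i : Fin (m + 3)) : i + 1 ≠ i := by
  rw [Ne, Fin.ext_iff, Fin.val_add_one]
  split_ifs with h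
  · rw [h]; simp
  · omega

lemma fin_add_one_add_one_ne (i : Fin (m + 3)) : i + 1 + 1 ≠ i := by
  intro h
  have h1 := Fin.val_add_one i
  have h2 := Fin.val_add_one (i + 1)
  rw [h] at h2
  simp only [Fin.ext_iff, Fin.val_last] at h1 h2
  split_ifs at h1 h2 <;> omega

lemma cycleMatrix_transpose (f : Fin (m + 3) → Bool) (a w : Fin (m + 3) → ℝ) :
    (cycleMatrix f a w)ᵀ = cycleMatrix (fun i => !f i) a w := by
  ext i j
  simp only [cycleMatrix, Matrix.transpose_apply, Matrix.of_apply]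
  have h1 : (if i = j then a j else 0) = if j = i then a i else 0 := by
    by_cases h : i = j
    · simp [h]
    · simp [h, Ne.symm h]
  have h2 : (i = j + 1) ↔ (j = i - 1) := by rw [eq_sub_iff_add_eq, eq_comm]
  have h3 : (i = j - 1) ↔ (j = i + 1) := by rw [eq_sub_iff_add_eq, eq_comm]
  simp only [h1, h2, h3]
  by_cases hi : f i = true <;> by_cases hj : f j = true <;> simp [hi, hj] <;> ring

lemma cycleMatrix_mulVec {f : Fin (m + 3) → Bool} {a w l r : Fin (m + 3) → ℝ}
    (hpass : ∀ i, f (i - 1) = f i →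
      a i * l i + w i * l (i + 1) = r i ∧ a i * r i + w (i - 1) * r (i - 1) = l i)
    (hhub : ∀ i, f (i - 1) ≠ f i →
      r i = l i ∧ w (i - 1) * r (i - 1) + w i * l (i + 1) = (1 - a i ^ 2) * l i) :
    cycleMatrix f a w *ᵥ cycleVec (fun i => !f i) a l r = cycleVec f a l r := by
  ext i
  have hsum : (cycleMatrix f a w *ᵥ cycleVec (fun i => !f i) a l r) i =
      a i * cycleVec (fun i => !f i) a l r i
      + (if f i then w i else 0) * cycleVec (fun i => !f i) a l r (i + 1)
      + (if f (i - 1) then 0 else w (i - 1)) * cycleVec (fun i => !f i) a l r (i - 1) := by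
    simp only [cycleMatrix, Matrix.mulVec, dotProduct, Matrix.of_apply, add_mul,
      Finset.sum_add_distrib, ite_mul, zero_mul, Finset.sum_ite_eq', Finset.mem_univ, if_true]
  have hnext : f i = true → cycleVec (fun i => !f i) a l r (i + 1) = l (i + 1) := by
    intro hi
    simp only [cycleVec, add_sub_cancel_right, hi]
    cases hi1 : f (i + 1) with
    | true => simp
    | false => simpa using (hhub (i + 1) (by simp [hi, hi1])).1
  have hprev : f (i - 1) = false → cycleVec (fun i => !f i) a l r (i - 1) = r (i - 1) := by
    intro hi
    simp [cycleVec, hi]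
  rw [hsum]
  cases h1 : f (i - 1) <;> cases h2 : f i
  · rw [hprev h1]
    have := (hpass i (by rw [h1, h2])).2
    simp [cycleVec, h1, h2]
    linarith
  · rw [hprev h1, hnext h2]
    obtain ⟨h3, h4⟩ := hhub i (by simp [h1, h2])
    simp [cycleVec, h1, h2]
    rw [h3]
    linarith
  · obtain ⟨h3, -⟩ := hhub i (by simp [h1, h2])
    simp [cycleVec, h1, h2, h3]
  · rw [hnext h2]
    have := (hpass i (by rw [h1, h2])).1
    simp [cycleVec, h1, h2]
    linarith

lemma cycleMatrix_transpose_mulVec {f : Fin (m + 3) → Bool} {a w l r : Fin (m + 3) → ℝ}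
    (hpass : ∀ i, f (i - 1) = f i →
      a i * l i + w i * l (i + 1) = r i ∧ a i * r i + w (i - 1) * r (i - 1) = l i)
    (hhub : ∀ i, f (i - 1) ≠ f i →
      r i = l i ∧ w (i - 1) * r (i - 1) + w i * l (i + 1) = (1 - a i ^ 2) * l i) :
    (cycleMatrix f a w)ᵀ *ᵥ cycleVec f a l r = cycleVec (fun i => !f i) a l r := by
  rw [cycleMatrix_transpose]
  have := cycleMatrix_mulVec (f := fun i => !f i) (a := a) (w := w) (l := l) (r := r)
    (fun i hi => hpass i (by simpa using hi)) (fun i hi => hhub i (by simpa using hi))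
  simpa only [Bool.not_not] using this

lemma eq_zero_of_cycleVec_eq_zero {f : Fin (m + 3) → Bool} {a l r : Fin (m + 3) → ℝ}
    (hhub : ∀ i, f (i - 1) ≠ f i → r i = l i) (h1 : cycleVec f a l r = 0)
    (h2 : cycleVec (fun i => !f i) a l r = 0) (i : Fin (m + 3)) : l i = 0 := by
  have e1 := congrFun h1 i
  have e2 := congrFun h2 i
  simp only [cycleVec, Pi.zero_apply] at e1 e2
  by_cases h : f (i - 1) = f i
  · cases hi : f i <;> simp_all
  · rw [← hhub i h]
    cases hi : f i <;> simp_all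

lemma hasPattern_cycleMatrix {f : Fin (m + 3) → Bool} {a w : Fin (m + 3) → ℝ}
    {Q : Matrix (Fin (m + 3)) (Fin (m + 3)) ℝ} (ha : ∀ i, a i ≠ 0) (hw : ∀ i, w i ≠ 0)
    (hdiag : ∀ i, Q i i = 1) (hf : ∀ i, f i = true ↔ Q i (i + 1) = 1)
    (hxor : ∀ i, Xor (Q i (i + 1) = 1) (Q (i + 1) i = 1))
    (hother : ∀ i j, j ≠ i → j ≠ i + 1 → i ≠ j + 1 → Q i j = 0) :
    HasPattern (cycleMatrix f a w) Q := by
  intro i j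
  simp only [cycleMatrix, Matrix.of_apply]
  by_cases h1 : j = i
  · subst h1
    have h2 : j ≠ j - 1 := fun h => fin_add_one_ne j (eq_sub_iff_add_eq.1 h)
    simp [(fin_add_one_ne j).symm, h2, ha, hdiag]
  by_cases h2 : j = i + 1
  · subst h2
    have h3 : i + 1 ≠ i - 1 := fun h => fin_add_one_add_one_ne i (eq_sub_iff_add_eq.1 h)
    rw [← hf]
    simp [h3, hw]
  by_cases h3 : i = j + 1
  · subst h3
    have h4 := hf j
    have h5 := hxor j
    simp only [if_neg h1, if_neg h2, add_sub_cancel_right, if_true, zero_add]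
    cases hj : f j <;> simp [hj] at h4 ⊢
    · rcases h5 with h | h
      · exact absurd h.1 h4
      · exact ⟨fun _ => h.1, fun _ => hw j⟩
    · rcases h5 with h | h
      · exact h.2
      · exact absurd h4 h.2
  · have h4 : j ≠ i - 1 := fun h => h3 (eq_sub_iff_add_eq.1 h).symm
    simp [h1, h2, h4, hother i j h1 h2 h3]

lemma exists_partial_sums (step : Fin (m + 3) → ℝ) :
    ∃ κ : Fin (m + 3) → ℝ, κ 0 = 0 ∧
      ∀ i, κ (i + 1) = κ i + step i - if i = Fin.last (m + 2) then ∑ j, step j else 0 := by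
  refine ⟨fun i => ∑ j ∈ Finset.Iio i, step j, ?_, fun i => ?_⟩
  · exact Finset.sum_eq_zero fun j hj => absurd (Finset.mem_Iio.1 hj) (Fin.not_lt_zero j)
  · have hIic : ∑ j ∈ Finset.Iio i, step j + step i = ∑ j ∈ Finset.Iic i, step j := by
      rw [← Finset.Iio_insert, Finset.sum_insert (by simp), add_comm]
    simp only [hIic]
    split_ifs with h
    · have hlast : i + 1 = 0 := by rw [h]; exact Fin.last_add_one _
      have huniv : Finset.Iic i = Finset.univ := by ext j; simp [h, Fin.le_last]
      rw [huniv, hlast, sub_self]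
      exact Finset.sum_eq_zero fun j hj => absurd (Finset.mem_Iio.1 hj) (Fin.not_lt_zero j)
    · have hI : Finset.Iio (i + 1) = Finset.Iic i := by
        ext j
        have hi := Fin.val_add_one i
        rw [if_neg h] at hi
        simp only [Finset.mem_Iio, Finset.mem_Iic, Fin.lt_def, Fin.le_def, hi]
        omega
      rw [hI, sub_zero]

/-- The solutions of `E (t - 1) + E (t + 1) = 2 * cos φ * E t` used on the cycle. -/
noncomputable def wave (φ α β t : ℝ) : ℝ := α * Real.cos (φ * t) + β * Real.sin (φ * t)

lemma wave_sub_one_add_wave_add_one (φ α β t : ℝ) :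
    wave φ α β (t - 1) + wave φ α β (t + 1) = 2 * Real.cos φ * wave φ α β t := by
  simp only [wave, mul_sub, mul_add, mul_one, Real.cos_sub, Real.cos_add, Real.sin_sub,
    Real.sin_add]
  ring

lemma wave_sub_antiperiod {φ M : ℝ} (h : φ * M = Real.pi) (α β t : ℝ) :
    wave φ α β (t - M) = -wave φ α β t := by
  simp only [wave, mul_sub, h, Real.cos_sub_pi, Real.sin_sub_pi]
  ring

theorem exists_hasPattern_of_cycle {Q : Matrix (Fin (m + 3)) (Fin (m + 3)) ℝ}
    (hdiag : ∀ i, Q i i = 1) (hxor : ∀ i, Xor (Q i (i + 1) = 1) (Q (i + 1) i = 1))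
    (hother : ∀ i j, j ≠ i → j ≠ i + 1 → i ≠ j + 1 → Q i j = 0) :
    ∃ A : Matrix (Fin (m + 3)) (Fin (m + 3)) ℝ, HasPattern A Q ∧ 2 ≤ singValMult A 1 := by
  classical
  set f : Fin (m + 3) → Bool := fun i => decide (Q i (i + 1) = 1) with hf
  set step : Fin (m + 3) → ℝ := fun i => if f (i - 1) = f i then 2 else 1 with hstep
  have hstep1 : ∀ i, 1 ≤ step i := fun i => by simp only [hstep]; split_ifs <;> norm_num
  have hstep2 : ∀ i, step i ≤ 2 := fun i => by simp only [hstep]; split_ifs <;> norm_num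
  obtain ⟨κ, hκ0, hκ⟩ := exists_partial_sums step
  set M : ℝ := ∑ j, step j with hM
  have hM3 : 3 ≤ M := by
    have h : ∑ _j : Fin (m + 3), (1 : ℝ) ≤ M := Finset.sum_le_sum fun i _ => hstep1 i
    simp only [Finset.sum_const, Finset.card_univ, Fintype.card_fin, nsmul_eq_mul, mul_one] at h
    push_cast at h
    linarith [(Nat.cast_nonneg m : (0 : ℝ) ≤ m)]
  set φ : ℝ := Real.pi / M with hφ
  have hφM : φ * M = Real.pi := div_mul_cancel₀ _ (by linarith)
  have hφ0 : 0 < φ := div_pos Real.pi_pos (by linarith)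
  have hc : 0 < Real.cos φ :=
    Real.cos_pos_of_mem_Ioo ⟨by linarith [Real.pi_pos], by nlinarith⟩
  set c := Real.cos φ with hcdef
  set a : Fin (m + 3) → ℝ := fun i => if f (i - 1) = f i then 1 / (2 * c) else 1 / 2 with ha
  set s : Fin (m + 3) → ℝ :=
    fun i => √(if f (i - 1) = f i then 1 / (2 * c) else 3 / (8 * c)) with hs
  have hs0 : ∀ i, 0 < s i := fun i => Real.sqrt_pos.2 (by split_ifs <;> positivity)
  have hss : ∀ i, s i * s i = if f (i - 1) = f i then 1 / (2 * c) else 3 / (8 * c) :=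
    fun i => Real.mul_self_sqrt (by split_ifs <;> positivity)
  set sg : Fin (m + 3) → ℝ := fun i => if i = Fin.last (m + 2) then -1 else 1 with hsg
  have hsg2 : ∀ i, sg i * sg i = 1 := fun i => by simp only [hsg]; split_ifs <;> norm_num
  set w : Fin (m + 3) → ℝ := fun i => sg i * s i * s (i + 1) with hw
  have hE : ∀ α β i t, wave φ α β (κ (i + 1) + t) = sg i * wave φ α β (κ i + step i + t) := by
    intro α β i t
    rw [hκ]
    simp only [hsg]
    split_ifs with h
    · rw [show κ i + step i - M + t = κ i + step i + t - M by ring, wave_sub_antiperiod hφM,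
        neg_one_mul]
    · simp
  let l : ℝ → ℝ → Fin (m + 3) → ℝ := fun α β i => wave φ α β (κ i) / s i
  let r : ℝ → ℝ → Fin (m + 3) → ℝ := fun α β i => wave φ α β (κ i + step i - 1) / s i
  have hwr : ∀ α β i, w i * r α β i = s (i + 1) * wave φ α β (κ (i + 1) - 1) := by
    intro α β i
    have := (hs0 i).ne'
    rw [sub_eq_add_neg, hE, ← sub_eq_add_neg]
    simp only [hw, r]
    field_simp
  have hwl : ∀ α β i, w i * l α β (i + 1) = s i * wave φ α β (κ i + step i) := by
    intro α β i
    have := (hs0 (i + 1)).ne'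
    have h := hE α β i 0
    rw [add_zero, add_zero] at h
    simp only [hw, l]
    rw [h]
    field_simp
    linear_combination s i * wave φ α β (κ i + step i) * hsg2 i
  have hpass : ∀ α β i, f (i - 1) = f i → a i * l α β i + w i * l α β (i + 1) = r α β i ∧
      a i * r α β i + w (i - 1) * r α β (i - 1) = l α β i := by
    intro α β i hi
    have h0 := (hs0 i).ne'
    have hs2 := hss i
    have ha' : a i = s i * s i := by rw [hs2]; simp only [ha, if_pos hi]
    have hst : step i = 2 := by simp only [hstep, if_pos hi]
    rw [if_pos hi, eq_div_iff (by positivity)] at hs2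
    have e1 := wave_sub_one_add_wave_add_one φ α β (κ i + 1)
    have e2 := wave_sub_one_add_wave_add_one φ α β (κ i)
    rw [add_sub_cancel_right, add_assoc, one_add_one_eq_two] at e1
    have h1 := hwr α β (i - 1)
    rw [sub_add_cancel] at h1
    rw [hwl, h1, ha']
    simp only [l, r, hst]
    rw [add_sub_assoc, show (2 : ℝ) - 1 = 1 by norm_num]
    constructor
    · field_simp
      linear_combination s i ^ 2 * e1 + wave φ α β (κ i + 1) * hs2
    · field_simp
      linear_combination s i ^ 2 * e2 + wave φ α β (κ i) * hs2
  have hhub : ∀ α β i, f (i - 1) ≠ f i → r α β i = l α β i ∧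
      w (i - 1) * r α β (i - 1) + w i * l α β (i + 1) = (1 - a i ^ 2) * l α β i := by
    intro α β i hi
    have h0 := (hs0 i).ne'
    have hs2 := hss i
    have ha' : a i = 1 / 2 := by simp only [ha, if_neg hi]
    have hst : step i = 1 := by simp only [hstep, if_neg hi]
    rw [if_neg hi, eq_div_iff (by positivity)] at hs2
    have e2 := wave_sub_one_add_wave_add_one φ α β (κ i)
    have h1 := hwr α β (i - 1)
    rw [sub_add_cancel] at h1
    rw [hwl, h1, ha']
    simp only [l, r, hst]
    rw [add_sub_cancel_right]
    refine ⟨rfl, ?_⟩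
    field_simp
    linear_combination 4 * s i ^ 2 * e2 + wave φ α β (κ i) * hs2
  have heig : ∀ α β, cycleMatrix f a w *ᵥ ((cycleMatrix f a w)ᵀ *ᵥ cycleVec f a (l α β) (r α β)) =
      cycleVec f a (l α β) (r α β) := fun α β => by
    rw [cycleMatrix_transpose_mulVec (hpass α β) (hhub α β),
      cycleMatrix_mulVec (hpass α β) (hhub α β)]
  refine ⟨cycleMatrix f a w, hasPattern_cycleMatrix (fun i => ?_) (fun i => ?_) hdiag
    (fun i => by simp [hf]) hxor hother, two_le_singValMult (u := cycleVec f a (l 1 0) (r 1 0))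
    (v := cycleVec f a (l 0 1) (r 0 1)) ?_ (by rw [heig]; simp) (by rw [heig]; simp)⟩
  · simp only [ha]
    split_ifs <;> positivity
  · have h1 := (hs0 i).ne'
    have h2 := (hs0 (i + 1)).ne'
    have h3 : sg i ≠ 0 := left_ne_zero_of_mul_eq_one (hsg2 i)
    exact mul_ne_zero (mul_ne_zero h3 h1) h2
  · rw [LinearIndependent.pair_iff]
    intro α β h
    have hlin : α • cycleVec f a (l 1 0) (r 1 0) + β • cycleVec f a (l 0 1) (r 0 1) =
        cycleVec f a (l α β) (r α β) := by
      ext i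
      simp only [cycleVec, l, r, wave, Pi.add_apply, Pi.smul_apply, smul_eq_mul]
      split_ifs <;> ring
    rw [hlin] at h
    have h' := cycleMatrix_transpose_mulVec (hpass α β) (hhub α β)
    rw [h, Matrix.mulVec_zero] at h'
    have hl : ∀ i, wave φ α β (κ i) = 0 := fun i => by
      have := eq_zero_of_cycleVec_eq_zero (fun i hi => (hhub α β i hi).1) h h'.symm i
      simpa [l, (hs0 i).ne'] using this
    have hα : α = 0 := by simpa [wave, hκ0] using hl 0
    refine ⟨hα, ?_⟩
    have h1 := hl (0 + 1)
    rw [hκ, hκ0, if_neg (by simp [Fin.ext_iff])] at h1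
    simp only [wave, hα, zero_mul, zero_add, sub_zero] at h1
    refine (mul_eq_zero.1 h1).resolve_right (Real.sin_pos_of_pos_of_lt_pi ?_ ?_).ne'
    · exact mul_pos hφ0 (by linarith [hstep1 0])
    · rw [← hφM]
      exact mul_lt_mul_of_pos_left (by linarith [hstep2 0]) hφ0

end Cycle

section Combinatorics

/-- Every matrix with pattern `P` has only simple singular values. -/
def RequiresSimple {α : Type*} [Fintype α] [DecidableEq α] (P : Matrix α α ℝ) : Prop :=
  ∀ A : Matrix α α ℝ, HasPattern A P → ∀ σ : ℝ, 0 ≤ σ → singValMult A σ ≤ 1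

/-- Distinct vertices joined by an arc, in either direction, of the digraph of `P`. -/
def ArcJoined {α : Type*} (P : Matrix α α ℝ) (i j : α) : Prop :=
  i ≠ j ∧ (P i j = 1 ∨ P j i = 1)

lemma ArcJoined.symm {α : Type*} {P : Matrix α α ℝ} {i j : α} (h : ArcJoined P i j) :
    ArcJoined P j i :=
  ⟨h.1.symm, h.2.symm⟩

/-- An injective sequence of `k` vertices, consecutive ones joined. -/
def IsTrail {α : Type*} (P : Matrix α α ℝ) {k : ℕ} (f : Fin k → α) : Prop :=
  Function.Injective f ∧ ∀ i j : Fin k, (i : ℕ) + 1 = j → ArcJoined P (f i) (f j)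

lemma IsTrail.rev {α : Type*} {P : Matrix α α ℝ} {k : ℕ} {f : Fin k → α} (hf : IsTrail P f) :
    IsTrail P (f ∘ Fin.rev) := by
  refine ⟨hf.1.comp Fin.rev_injective, fun i j hij => (hf.2 _ _ ?_).symm⟩
  simp only [Fin.val_rev]
  omega

lemma IsTrail.snoc {α : Type*} {P : Matrix α α ℝ} {k : ℕ} {f : Fin k → α}
    (hf : IsTrail P f) {w : α} (hw : w ∉ Set.range f)
    (hlast : ∀ i : Fin k, (i : ℕ) + 1 = k → ArcJoined P (f i) w) :
    IsTrail P (Fin.snoc f w : Fin (k + 1) → α) := by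
  refine ⟨Fin.snoc_injective_of_injective hf.1 hw, fun i j hij => ?_⟩
  induction j using Fin.lastCases with
  | last =>
    induction i using Fin.lastCases with
    | last => simp at hij
    | cast i => simpa using hlast i (by simpa using hij)
  | cast j =>
    induction i using Fin.lastCases with
    | last => simp at hij; omega
    | cast i => simpa using hf.2 i j (by simpa using hij)

variable {α γ : Type*} [Fintype α] [DecidableEq α] [Fintype γ] [DecidableEq γ] {P : Matrix α α ℝ}

lemma RequiresSimple.transpose (h : RequiresSimple P) : RequiresSimple Pᵀ := by
  intro A hA σ hσ
  rw [← singValMult_transpose]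
  exact h _ (fun i j => hA j i) σ hσ

lemma RequiresSimple.submatrix (h : RequiresSimple P) (e : γ ≃ α) :
    RequiresSimple (P.submatrix e e) := by
  intro A hA σ hσ
  rw [← singValMult_submatrix A e.symm]
  refine h _ (fun i j => ?_) σ hσ
  simpa using hA (e.symm i) (e.symm j)

lemma RequiresSimple.not_embedded (h : RequiresSimple P) (hdiag : ∀ i, P i i = 1)
    {A : Matrix γ γ ℝ} {σ : ℝ} (hA : SSVP A) (hσ : 0 ≤ σ) (hm : 2 ≤ singValMult A σ) {g : γ → α}
    (hg : Function.Injective g) : ¬∀ i j, A i j ≠ 0 → P (g i) (g j) = 1 := by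
  intro hAP
  obtain ⟨B, hB, hle⟩ := hA.exists_hasPattern_of_injective hdiag hg hAP
  have := h B hB σ hσ
  have := hle σ
  omega

lemma RequiresSimple.not_two_cycle (h : RequiresSimple P) (hdiag : ∀ i, P i i = 1) {i j : α}
    (hij : i ≠ j) (h1 : P i j = 1) (h2 : P j i = 1) : False := by
  refine h.not_embedded hdiag ssvp_rotation (Real.sqrt_nonneg 2) two_le_singValMult_rotation
    (g := ![i, j]) ?_ ?_
  · intro a b hab
    fin_cases a <;> fin_cases b <;> simp_all
  · intro a b _
    fin_cases a <;> fin_cases b <;> simp [hdiag, h1, h2]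

lemma RequiresSimple.not_star_out (h : RequiresSimple P) (hdiag : ∀ i, P i i = 1) {x a b c : α}
    (hxa : x ≠ a) (hxb : x ≠ b) (hxc : x ≠ c) (hab : a ≠ b) (hac : a ≠ c) (hbc : b ≠ c)
    (h1 : P x a = 1) (h2 : P x b = 1) (h3 : P x c = 1 ∨ P c x = 1) : False := by
  have hinj : Function.Injective ![x, a, b, c] := by
    intro i j hij
    fin_cases i <;> fin_cases j <;> simp_all
  rcases h3 with h3 | h3
  · refine h.not_embedded hdiag ssvp_star_out zero_le_one two_le_singValMult_star_out hinj ?_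
    intro i j
    fin_cases i <;> fin_cases j <;> simp [hdiag, h1, h2, h3]
  · refine h.not_embedded hdiag ssvp_star_mixed (by norm_num) two_le_singValMult_star_mixed hinj ?_
    intro i j
    fin_cases i <;> fin_cases j <;> simp [hdiag, h1, h2, h3]

lemma RequiresSimple.not_three_joined (h : RequiresSimple P) (hdiag : ∀ i, P i i = 1)
    {x a b c : α} (ha : ArcJoined P x a) (hb : ArcJoined P x b) (hc : ArcJoined P x c)
    (hab : a ≠ b) (hac : a ≠ c) (hbc : b ≠ c) : False := by
  obtain ⟨hxa, ha⟩ := ha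
  obtain ⟨hxb, hb⟩ := hb
  obtain ⟨hxc, hc⟩ := hc
  have hT := h.transpose
  have hTd : ∀ i, Pᵀ i i = 1 := hdiag
  rcases id ha with ha' | ha' <;> rcases id hb with hb' | hb'
  · exact h.not_star_out hdiag hxa hxb hxc hab hac hbc ha' hb' hc
  · rcases id hc with hc' | hc'
    · exact h.not_star_out hdiag hxa hxc hxb hac hab hbc.symm ha' hc' hb
    · exact hT.not_star_out hTd hxb hxc hxa hbc hab.symm hac.symm hb' hc' ha.symm
  · rcases id hc with hc' | hc'
    · exact h.not_star_out hdiag hxb hxc hxa hbc hab.symm hac.symm hb' hc' ha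
    · exact hT.not_star_out hTd hxa hxc hxb hac hab hbc.symm ha' hc' hb.symm
  · exact hT.not_star_out hTd hxa hxb hxc hab hac hbc ha' hb' hc.symm

lemma RequiresSimple.eq_univ_of_closed (h : RequiresSimple P) (hP : IsPattern P)
    (hdiag : ∀ i, P i i = 1) {S : Set α} (hS : S.Nonempty)
    (hclosed : ∀ i ∈ S, ∀ j ∉ S, ¬ArcJoined P i j) : S = Set.univ := by
  by_contra hne
  obtain ⟨A, hA, hA2⟩ := exists_hasPattern_of_disconnected hP hdiag hS
    (Set.nonempty_compl.2 hne) fun i hi j hj => by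
      have hij := hclosed i hi j hj
      rw [ArcJoined, not_and_or, not_or] at hij
      rcases hij with hij | hij
      · exact (hij fun e => hj (e ▸ hi)).elim
      · exact ⟨(hP i j).resolve_right hij.1, (hP j i).resolve_right hij.2⟩
  have := h A hA 1 zero_le_one
  omega

lemma RequiresSimple.joined_interior (h : RequiresSimple P) (hdiag : ∀ i, P i i = 1) {k : ℕ}
    {f : Fin k → α} (hf : IsTrail P f) {i : Fin k} (h0 : (i : ℕ) ≠ 0) (h1 : (i : ℕ) + 1 ≠ k)
    {w : α} (hw : ArcJoined P (f i) w) :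
    ∃ j : Fin k, ((j : ℕ) + 1 = i ∨ (i : ℕ) + 1 = j) ∧ f j = w := by
  by_contra! hne
  have e0 : ((⟨i - 1, by omega⟩ : Fin k) : ℕ) + 1 = i := by simp; omega
  have e1 : (i : ℕ) + 1 = ((⟨i + 1, by omega⟩ : Fin k) : ℕ) := rfl
  refine h.not_three_joined hdiag (hf.2 _ _ e0).symm (hf.2 _ _ e1) hw (fun e => ?_)
    (hne _ (Or.inl e0)) (hne _ (Or.inr e1))
  have := congrArg Fin.val (hf.1 e)
  simp at this

lemma RequiresSimple.exists_trail_equiv {n : ℕ} {P : Matrix (Fin n) (Fin n) ℝ}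
    (h : RequiresSimple P) (hP : IsPattern P) (hdiag : ∀ i, P i i = 1) :
    ∃ v : Fin n ≃ Fin n, IsTrail P v := by
  classical
  rcases Nat.eq_zero_or_pos n with rfl | hn
  · exact ⟨Equiv.refl _, Function.injective_id, fun i => i.elim0⟩
  let p : ℕ → Prop := fun k => ∃ f : Fin k → Fin n, IsTrail P f
  have hle : ∀ k, p k → k ≤ n := fun k ⟨f, hf⟩ => by
    simpa using Fintype.card_le_of_injective f hf.1
  have hp1 : p 1 :=
    ⟨fun _ => ⟨0, hn⟩, Function.injective_of_subsingleton _, fun i j hij => by omega⟩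
  set k := Nat.findGreatest p n with hk
  have hk1 : 1 ≤ k := Nat.le_findGreatest hn hp1
  obtain ⟨f, hf⟩ : p k := Nat.findGreatest_spec hn hp1
  have hmax : ¬p (k + 1) := fun hp => by
    have := Nat.le_findGreatest (hle _ hp) hp
    omega
  have hend : ∀ {g : Fin k → Fin n}, IsTrail P g → ∀ i : Fin k, (i : ℕ) + 1 = k →
      ∀ w ∉ Set.range g, ¬ArcJoined P (g i) w := fun {g} hg i hi w hw hj =>
    hmax ⟨_, hg.snoc hw fun j hj' => by
      rwa [show j = i from Fin.ext (by omega)]⟩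
  have hclosed : ∀ x ∈ Set.range f, ∀ w ∉ Set.range f, ¬ArcJoined P x w := by
    rintro _ ⟨i, rfl⟩ w hw hj
    by_cases h1 : (i : ℕ) + 1 = k
    · exact hend hf i h1 w hw hj
    by_cases h0 : (i : ℕ) = 0
    · refine hend hf.rev i.rev (by rw [Fin.val_rev]; omega) w ?_ (by simpa using hj)
      rwa [Fin.rev_surjective.range_comp]
    · obtain ⟨j, -, hj⟩ := h.joined_interior hdiag hf h0 h1 hj
      exact hw ⟨j, hj⟩
  have hsurj := Set.range_eq_univ.1
    (h.eq_univ_of_closed hP hdiag ⟨f ⟨0, hk1⟩, Set.mem_range_self _⟩ hclosed)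
  have hkn : k = n := by simpa using Fintype.card_of_bijective ⟨hf.1, hsurj⟩
  clear_value k
  subst hkn
  exact ⟨Equiv.ofBijective f ⟨hf.1, hsurj⟩, hf⟩

lemma RequiresSimple.xor (h : RequiresSimple P) (hdiag : ∀ i, P i i = 1) {i j : α}
    (hij : ArcJoined P i j) : Xor (P i j = 1) (P j i = 1) := by
  rcases hij.2 with h1 | h1
  · exact Or.inl ⟨h1, fun h2 => h.not_two_cycle hdiag hij.1 h1 h2⟩
  · exact Or.inr ⟨h1, fun h2 => h.not_two_cycle hdiag hij.1 h2 h1⟩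

lemma RequiresSimple.not_cycle {m : ℕ} {Q : Matrix (Fin (m + 3)) (Fin (m + 3)) ℝ}
    (h : RequiresSimple Q) (hP : IsPattern Q) (hdiag : ∀ i, Q i i = 1) (hQ : IsTrail Q id) :
    ¬ArcJoined Q 0 (Fin.last (m + 2)) := by
  intro h0
  have hadj : ∀ i : Fin (m + 3), ArcJoined Q i (i + 1) := by
    intro i
    by_cases hi : i = Fin.last (m + 2)
    · rw [hi, Fin.last_add_one]
      exact h0.symm
    · exact hQ.2 i (i + 1) (by rw [Fin.val_add_one, if_neg hi])
  obtain ⟨A, hA, hA2⟩ := exists_hasPattern_of_cycle hdiag (fun i => h.xor hdiag (hadj i))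
    fun i j h1 h2 h3 => by
      refine (hP i j).resolve_right fun hij => ?_
      have h3' : j ≠ i - 1 := fun e => h3 (eq_sub_iff_add_eq.1 e).symm
      have h4 := hadj (i - 1)
      rw [sub_add_cancel] at h4
      exact h.not_three_joined hdiag (hadj i) h4.symm ⟨h1.symm, Or.inl hij⟩
        (fun e => fin_add_one_add_one_ne i (eq_sub_iff_add_eq.1 e)) h2.symm h3'.symm
  have := h A hA 1 zero_le_one
  omega

theorem RequiresSimple.isWeakPath {n : ℕ} {P : Matrix (Fin n) (Fin n) ℝ}
    (h : RequiresSimple P) (hP : IsPattern P) (hdiag : ∀ i, P i i = 1) : IsWeakPath P := by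
  obtain ⟨v, hv⟩ := h.exists_trail_equiv hP hdiag
  set Q := P.submatrix v v with hQ
  have hQh : RequiresSimple Q := h.submatrix v
  have hQP : IsPattern Q := fun i j => hP _ _
  have hQd : ∀ i, Q i i = 1 := fun i => hdiag _
  have hQt : IsTrail Q id :=
    ⟨Function.injective_id, fun i j hij => ⟨fun e => (hv.2 i j hij).1 (congrArg v e),
      (hv.2 i j hij).2⟩⟩
  have hint : ∀ i j, ArcJoined Q i j → ((i : ℕ) = 0 ∨ (i : ℕ) + 1 = n) ∨
      (j : ℕ) + 1 = i ∨ (i : ℕ) + 1 = j := by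
    intro i j hij
    by_contra! hne
    obtain ⟨j', hj', rfl⟩ := hQh.joined_interior hQd hQt hne.1.1 hne.1.2 hij
    exact hj'.elim hne.2.1 hne.2.2
  have hcyc : ∀ i j : Fin n, (i : ℕ) = 0 → (j : ℕ) + 1 = n → (i : ℕ) + 1 ≠ j → ¬ArcJoined Q i j := by
    intro i j hi hj hij hJ
    have hne : (i : ℕ) ≠ j := fun e => hJ.1 (Fin.ext e)
    obtain ⟨m, rfl⟩ : ∃ m, n = m + 3 := ⟨n - 3, by omega⟩
    refine hQh.not_cycle hQP hQd hQt ?_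
    rwa [show (0 : Fin (m + 3)) = i from Fin.ext hi.symm,
      show Fin.last (m + 2) = j from Fin.ext (by simp; omega)]
  have hno : ∀ i j, ArcJoined Q i j → (i : ℕ) + 1 = j ∨ (j : ℕ) + 1 = i := by
    intro i j hij
    have hne : (i : ℕ) ≠ j := fun e => hij.1 (Fin.ext e)
    by_contra! hcon
    have h1 := hint i j hij
    have h2 := hint j i hij.symm
    have h3 : ¬((i : ℕ) = 0 ∧ (j : ℕ) + 1 = n) := fun h => hcyc i j h.1 h.2 hcon.1 hij
    have h4 : ¬((j : ℕ) = 0 ∧ (i : ℕ) + 1 = n) := fun h => hcyc j i h.1 h.2 hcon.2 hij.symm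
    omega
  refine ⟨v, fun a b hab => ⟨fun hc => ?_, fun hc => ?_⟩⟩
  · refine hQh.xor hQd ?_
    exact hc.elim (hQt.2 a b) fun e => (hQt.2 b a e).symm
  · exact (hQP a b).resolve_right fun e => hc (hno a b ⟨hab, Or.inl e⟩)

end Combinatorics

/-- Let `P` be an `n × n` pattern with term-rank `n` in standard form (all diagonal
entries `1`).  Every matrix with pattern `P` has all simple singular values if and only if
the digraph of `P` is a weak path. -/
theorem requires_simple_iff_weakPath {n : ℕ} (P : Matrix (Fin n) (Fin n) ℝ)
    (hP : IsPattern P) (hdiag : ∀ i, P i i = 1) :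
    (∀ A : Matrix (Fin n) (Fin n) ℝ, HasPattern A P →
        ∀ σ : ℝ, 0 ≤ σ → singValMult A σ ≤ 1) ↔
      IsWeakPath P :=
  ⟨fun h => RequiresSimple.isWeakPath h hP hdiag,
    fun h _ hA σ _ => h.singValMult_le_one hdiag hA σ⟩
end

section
/- Every 3×4 real matrix with pattern [[1,0,0,0],[1,1,0,0],[1,0,1,1]] has three distinct singular values (each singular value has multiplicity 1). -/
open Matrix Polynomial

/-- Two orthogonal vectors of `ℝ³`, both orthogonal to two vectors `p` and `q` whose minor in the
first and third coordinates does not vanish, cannot both be nonzero. -/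
lemma eq_zero_or_eq_zero_of_orthogonal {p q u w : Fin 3 → ℝ}
    (h : p 0 * q 2 - p 2 * q 0 ≠ 0)
    (hpu : p ⬝ᵥ u = 0) (hqu : q ⬝ᵥ u = 0) (hpw : p ⬝ᵥ w = 0) (hqw : q ⬝ᵥ w = 0)
    (huw : u ⬝ᵥ w = 0) : u = 0 ∨ w = 0 := by
  have key : ∀ z : Fin 3 → ℝ, p ⬝ᵥ z = 0 → q ⬝ᵥ z = 0 →
      (p 0 * q 2 - p 2 * q 0) * z 0 = (p 2 * q 1 - p 1 * q 2) * z 1 ∧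
      (p 0 * q 2 - p 2 * q 0) * z 2 = (p 1 * q 0 - p 0 * q 1) * z 1 := by
    intro z hp hq
    simp only [dotProduct, Fin.sum_univ_three] at hp hq
    constructor
    · linear_combination q 2 * hp - p 2 * hq
    · linear_combination p 0 * hq - q 0 * hp
  have vanish : ∀ z : Fin 3 → ℝ, p ⬝ᵥ z = 0 → q ⬝ᵥ z = 0 → z 1 = 0 → z = 0 := by
    intro z hp hq hz
    obtain ⟨h0, h2⟩ := key z hp hq
    simp only [hz, mul_zero, mul_eq_zero, h, false_or] at h0 h2
    ext i
    fin_cases i <;> assumption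
  obtain ⟨hu0, hu2⟩ := key u hpu hqu
  obtain ⟨hw0, hw2⟩ := key w hpw hqw
  simp only [dotProduct, Fin.sum_univ_three] at huw
  generalize p 0 * q 2 - p 2 * q 0 = m at *
  generalize p 2 * q 1 - p 1 * q 2 = k at *
  generalize p 1 * q 0 - p 0 * q 1 = l at *
  have hmul : (m ^ 2 + k ^ 2 + l ^ 2) * (u 1 * w 1) = 0 := by
    linear_combination m ^ 2 * huw - m * w 0 * hu0 - k * u 1 * hw0 - m * w 2 * hu2 - l * u 1 * hw2
  have hpos : m ^ 2 + k ^ 2 + l ^ 2 ≠ 0 := by positivity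
  rcases mul_eq_zero.mp ((mul_eq_zero.mp hmul).resolve_left hpos) with h1 | h1
  · exact Or.inl (vanish u hpu hqu h1)
  · exact Or.inr (vanish w hpw hqw h1)

/-- Every `3 × 4` matrix with pattern `[[1,0,0,0],[1,1,0,0],[1,0,1,1]]` has three distinct
singular values: `A * Aᵀ` has three distinct eigenvalues, i.e. its characteristic
polynomial has three distinct real roots. -/
theorem aster_distinct_singular_values (A : Matrix (Fin 3) (Fin 4) ℝ)
    (hA : HasPattern A !![1, 0, 0, 0;
                          1, 1, 0, 0;
                          1, 0, 1, 1]) :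
    ∃ f : Fin 3 → ℝ, Function.Injective f ∧
      (A * Aᵀ).charpoly = ∏ i, (X - C (f i)) := by
  have hz : ∀ i j, (!![1, 0, 0, 0; 1, 1, 0, 0; 1, 0, 1, 1] : Matrix (Fin 3) (Fin 4) ℝ) i j = 0 →
      A i j = 0 := by
    intro i j h
    by_contra hne
    rw [(hA i j).mp hne] at h
    exact one_ne_zero h
  have h01 := hz 0 1 rfl
  have h02 := hz 0 2 rfl
  have h03 := hz 0 3 rfl
  have h12 := hz 1 2 rfl
  have h13 := hz 1 3 rfl
  have h21 := hz 2 1 rfl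
  have h00 : A 0 0 ≠ 0 := (hA 0 0).mpr rfl
  have h10 : A 1 0 ≠ 0 := (hA 1 0).mpr rfl
  have h11 : A 1 1 ≠ 0 := (hA 1 1).mpr rfl
  have h20 : A 2 0 ≠ 0 := (hA 2 0).mpr rfl
  have h22 : A 2 2 ≠ 0 := (hA 2 2).mpr rfl
  have hM : (A * Aᵀ).IsHermitian := by
    simpa using isHermitian_mul_conjTranspose_self A
  refine ⟨hM.eigenvalues, ?_, by simpa using hM.charpoly_eq⟩
  intro i j hij
  by_contra hne
  set l := hM.eigenvalues i with hl
  have hu := hM.mulVec_eigenvectorBasis i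
  have hw := hM.mulVec_eigenvectorBasis j
  have hu_ne := hM.eigenvectorBasis.orthonormal.ne_zero i
  have hw_ne := hM.eigenvectorBasis.orthonormal.ne_zero j
  have huw := hM.eigenvectorBasis.orthonormal.2 hne
  rw [← hl] at hu
  rw [← hij] at hw
  generalize hM.eigenvectorBasis i = u at *
  generalize hM.eigenvectorBasis j = w at *
  set B : Matrix (Fin 3) (Fin 3) ℝ := A * Aᵀ - l • 1 with hB
  have hrow : ∀ z : EuclideanSpace ℝ (Fin 3), (A * Aᵀ) *ᵥ z = l • (z : Fin 3 → ℝ) →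
      ∀ k, B k ⬝ᵥ z = 0 := by
    intro z h k
    change (B *ᵥ z) k = 0
    rw [hB, sub_mulVec, smul_mulVec, one_mulVec, h, sub_self, Pi.zero_apply]
  by_cases hl0 : l = 0
  · apply hu_ne
    have e0 := congrFun hu 0
    have e1 := congrFun hu 1
    have e2 := congrFun hu 2
    simp only [hl0, mulVec, dotProduct, Fin.sum_univ_three, Fin.sum_univ_four, mul_apply,
      transpose_apply, h01, h02, h03, h12, h13, h21, Pi.smul_apply, zero_smul, mul_zero, zero_mul,
      add_zero] at e0 e1 e2
    have hv : A 0 0 * u 0 + A 1 0 * u 1 + A 2 0 * u 2 = 0 := by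
      apply mul_left_cancel₀ h00
      linear_combination e0
    have hu1 : u 1 = 0 := by
      have : A 1 1 ^ 2 * u 1 = 0 := by linear_combination e1 - A 1 0 * hv
      simpa [h11] using this
    have hu2 : u 2 = 0 := by
      have : (A 2 2 ^ 2 + A 2 3 ^ 2) * u 2 = 0 := by linear_combination e2 - A 2 0 * hv
      exact (mul_eq_zero.mp this).resolve_left (by positivity)
    have hu0 : u 0 = 0 := by simpa [hu1, hu2, h00] using hv
    ext k
    fin_cases k <;> assumption
  · have hminor : B 0 0 * B 1 2 - B 0 2 * B 1 0 ≠ 0 := by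
      have : B 0 0 * B 1 2 - B 0 2 * B 1 0 = -(l * A 1 0 * A 2 0) := by
        simp [hB, mul_apply, Fin.sum_univ_four, h01, h02, h03, h12, h13, h21]
        ring
      rw [this]
      exact neg_ne_zero.mpr (mul_ne_zero (mul_ne_zero hl0 h10) h20)
    have huw' : (u : Fin 3 → ℝ) ⬝ᵥ w = 0 := by
      rw [EuclideanSpace.inner_eq_star_dotProduct] at huw
      rw [dotProduct_comm]
      simpa using huw
    rcases eq_zero_or_eq_zero_of_orthogonal hminor (hrow u hu 0) (hrow u hu 1) (hrow w hw 0)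
      (hrow w hw 1) huw' with h | h
    · exact hu_ne (WithLp.ofLp_injective 2 h)
    · exact hw_ne (WithLp.ofLp_injective 2 h)
end

section
/- Let P be an m×n pattern with m ≤ n having a column with exactly one 1, and let P⁺ be the m×(n+1) pattern obtained from P by appending a duplicate of that column. Then: (a) for each real matrix B ∈ Z(P⁺) there is a real matrix A ∈ Z(P) whose multiset of singular values equals that of B (equivalently, A·Aᵀ and B·Bᵀ have the same characteristic polynomial); (b) for each real matrix A ∈ Z(P) there is a real matrix B ∈ Z(P⁺) whose multiset of singular values equals that of A; and (c) some matrix in Z(P) has a multiple singular value if and only if some matrix in Z(P⁺) does. -/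
open Matrix Polynomial

/-- If `A` and `B` agree off column `j0` of `A`, and that column contributes to the Gram matrix
as much as the columns `j0` and `n` of `B` together, then `A` and `B` have the same Gram matrix. -/
lemma mul_transpose_eq_of_split_column {m n : ℕ} {A : Matrix (Fin m) (Fin n) ℝ}
    {B : Matrix (Fin m) (Fin (n + 1)) ℝ} (j0 : Fin n)
    (hoff : ∀ i j, j ≠ j0 → A i j = B i j.castSucc)
    (hcol : ∀ i k, A i j0 * A k j0 =
      B i j0.castSucc * B k j0.castSucc + B i (Fin.last n) * B k (Fin.last n)) :
    A * Aᵀ = B * Bᵀ := by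
  ext i k
  simp only [mul_apply, transpose_apply, Fin.sum_univ_castSucc]
  rw [← Finset.add_sum_erase _ _ (Finset.mem_univ j0),
    ← Finset.add_sum_erase _ (fun j : Fin n => B i j.castSucc * B k j.castSucc)
      (Finset.mem_univ j0), hcol,
    Finset.sum_congr rfl fun j hj => by
      rw [hoff i j (Finset.ne_of_mem_erase hj), hoff k j (Finset.ne_of_mem_erase hj)]]
  ring

/-- A pair of columns sharing a single nonzero position can be merged into one column without
changing the Gram matrix. -/
lemma exists_hasPattern_mul_transpose_eq_of_append {m n : ℕ} {P : Matrix (Fin m) (Fin n) ℝ}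
    {j0 : Fin n} (hj0 : ∃! i : Fin m, P i j0 = 1) {Pplus : Matrix (Fin m) (Fin (n + 1)) ℝ}
    (hdup : ∀ i (j : Fin n), Pplus i (Fin.castSucc j) = P i j)
    (hlast : ∀ i, Pplus i (Fin.last n) = P i j0)
    {B : Matrix (Fin m) (Fin (n + 1)) ℝ} (hB : HasPattern B Pplus) :
    ∃ A : Matrix (Fin m) (Fin n) ℝ, HasPattern A P ∧ A * Aᵀ = B * Bᵀ := by
  have hB₁ (i j) : B i (Fin.castSucc j) ≠ 0 ↔ P i j = 1 := by rw [hB, hdup]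
  have hB₂ (i) : B i (Fin.last n) ≠ 0 ↔ P i j0 = 1 := by rw [hB, hlast]
  have hzero (i) (hi : P i j0 ≠ 1) : B i j0.castSucc = 0 ∧ B i (Fin.last n) = 0 :=
    ⟨not_not.1 (mt (hB₁ i j0).1 hi), not_not.1 (mt (hB₂ i).1 hi)⟩
  refine ⟨.of fun i j => if j = j0 then √(B i j0.castSucc ^ 2 + B i (Fin.last n) ^ 2)
    else B i j.castSucc, fun i j => ?_, mul_transpose_eq_of_split_column j0 ?_ fun i k => ?_⟩
  · by_cases hj : j = j0
    · subst hj
      by_cases hi : P i j = 1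
      · have := (hB₁ i j).2 hi
        have hpos : 0 < √(B i j.castSucc ^ 2 + B i (Fin.last n) ^ 2) := by positivity
        simp [hi, hpos.ne']
      · simp [hi, hzero i hi]
    · simpa [hj] using hB₁ i j
  · intro i j hj
    simp [hj]
  · by_cases hi : P i j0 = 1
    · by_cases hk : P k j0 = 1
      · obtain rfl := hj0.unique hi hk
        simp only [of_apply, if_true]
        rw [Real.mul_self_sqrt (by positivity)]
        ring
      · simp [hzero k hk]
    · simp [hzero i hi]

/-- A column can be split into two proportional columns without changing the Gram matrix. -/
lemma exists_hasPattern_append_mul_transpose_eq {m n : ℕ} {P : Matrix (Fin m) (Fin n) ℝ}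
    {j0 : Fin n} {Pplus : Matrix (Fin m) (Fin (n + 1)) ℝ}
    (hdup : ∀ i (j : Fin n), Pplus i (Fin.castSucc j) = P i j)
    (hlast : ∀ i, Pplus i (Fin.last n) = P i j0)
    {A : Matrix (Fin m) (Fin n) ℝ} (hA : HasPattern A P) :
    ∃ B : Matrix (Fin m) (Fin (n + 1)) ℝ, HasPattern B Pplus ∧ A * Aᵀ = B * Bᵀ := by
  refine ⟨.of fun i => Fin.snoc (α := fun _ => ℝ)
    (fun j => if j = j0 then 3 / 5 * A i j else A i j) (4 / 5 * A i j0), fun i j => ?_,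
    mul_transpose_eq_of_split_column j0 ?_ fun i k => ?_⟩
  · induction j using Fin.lastCases with
    | last => simpa [hlast] using hA i j0
    | cast j =>
      rw [hdup, ← hA i j]
      by_cases hj : j = j0 <;> simp [hj]
  · intro i j hj
    simp [hj]
  · simp only [of_apply, Fin.snoc_castSucc, Fin.snoc_last, if_true]
    ring

/-- **Column augmentation.**  Let `P` be an `m × n` pattern (`m ≤ n`) having a column
`j0` with exactly one `1`, and let `Pplus` be the `m × (n+1)` pattern obtained from `P` by
appending a duplicate of that column.  Then (a) every matrix with pattern `Pplus` has the
same singular values (the same characteristic polynomial of the Gram matrix) as some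
matrix with pattern `P`; (b) conversely, every matrix with pattern `P` has the same
singular values as some matrix with pattern `Pplus`; and (c) `P` allows a matrix with a
multiple singular value iff `Pplus` does. -/
theorem column_augmentation {m n : ℕ} (hmn : m ≤ n)
    (P : Matrix (Fin m) (Fin n) ℝ) (hP : IsPattern P)
    (j0 : Fin n) (hj0 : ∃! i : Fin m, P i j0 = 1)
    (Pplus : Matrix (Fin m) (Fin (n + 1)) ℝ)
    (hdup : ∀ i (j : Fin n), Pplus i (Fin.castSucc j) = P i j)
    (hlast : ∀ i, Pplus i (Fin.last n) = P i j0) :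
    (∀ B : Matrix (Fin m) (Fin (n + 1)) ℝ, HasPattern B Pplus →
      ∃ A : Matrix (Fin m) (Fin n) ℝ, HasPattern A P ∧
        (A * Aᵀ).charpoly = (B * Bᵀ).charpoly) ∧
    (∀ A : Matrix (Fin m) (Fin n) ℝ, HasPattern A P →
      ∃ B : Matrix (Fin m) (Fin (n + 1)) ℝ, HasPattern B Pplus ∧
        (A * Aᵀ).charpoly = (B * Bᵀ).charpoly) ∧
    ((∃ A : Matrix (Fin m) (Fin n) ℝ, HasPattern A P ∧
        ∃ σ : ℝ, 0 ≤ σ ∧ 2 ≤ singValMult A σ) ↔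
      (∃ B : Matrix (Fin m) (Fin (n + 1)) ℝ, HasPattern B Pplus ∧
        ∃ σ : ℝ, 0 ≤ σ ∧ 2 ≤ singValMult B σ)) := by
  have hmerge (B : Matrix (Fin m) (Fin (n + 1)) ℝ) (hB : HasPattern B Pplus) :=
    exists_hasPattern_mul_transpose_eq_of_append hj0 hdup hlast hB
  have hsplit (A : Matrix (Fin m) (Fin n) ℝ) (hA : HasPattern A P) :=
    exists_hasPattern_append_mul_transpose_eq hdup hlast hA
  refine ⟨fun B hB => ?_, fun A hA => ?_, ?_, ?_⟩
  · obtain ⟨A, hA, h⟩ := hmerge B hB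
    exact ⟨A, hA, by rw [h]⟩
  · obtain ⟨B, hB, h⟩ := hsplit A hA
    exact ⟨B, hB, by rw [h]⟩
  · rintro ⟨A, hA, σ, hσ, hmult⟩
    obtain ⟨B, hB, h⟩ := hsplit A hA
    exact ⟨B, hB, σ, hσ, by rwa [singValMult, ← h]⟩
  · rintro ⟨B, hB, σ, hσ, hmult⟩
    obtain ⟨A, hA, h⟩ := hmerge B hB
    exact ⟨A, hA, σ, hσ, by rwa [singValMult, h]⟩
end

section
/- Let P be an m×n pattern with m ≤ n and term-rank m whose bigraph is an m×n Fiedler graph, and let A be a real matrix in Z(P). Then the singular values of A are distinct, i.e., A·Aᵀ has m distinct eigenvalues. -/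
open Matrix Polynomial

/-- The bigraph of an `m × n` pattern: the bipartite graph on row vertices `Sum.inl i`
and column vertices `Sum.inr j`, with an edge `{i, j'}` exactly when `P i j = 1`. -/
def bigraph {m n : ℕ} (P : Matrix (Fin m) (Fin n) ℝ) : SimpleGraph (Fin m ⊕ Fin n) :=
  SimpleGraph.fromRel (fun x y => ∃ i j, x = Sum.inl i ∧ y = Sum.inr j ∧ P i j = 1)

/-- The bigraph of the `m × n` pattern `P` (with `m ≤ n`) is an `m × n` Fiedler graph.
There is a core Fiedler graph, consisting of a path `p 0 — p 1 — ⋯ — p (ℓ-1)` together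
with `k` legs `u t — p (idx t)` attached at designated interior path vertices
`p (idx 0), …, p (idx (k-1))` (listed in increasing order of position along the path),
where the `1`-indexed positions `idx t + 1` of consecutive designated vertices are of
opposite parity, as are the pairs formed by position `1` with the first designated
position and by the last designated position with position `ℓ`; the core has
`ℓ + k = 2 m` vertices (`m` rows and `m` columns).  The remaining `n - m` column vertices
`c s` are pendant, each joined by a single edge to a row vertex `a s` lying on the path
and not incident to a leg.  The edges of the bigraph are exactly the path edges, the
legs, and these `n - m` pendant edges. -/
def IsFiedlerBigraph {m n : ℕ} (P : Matrix (Fin m) (Fin n) ℝ) : Prop :=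
  ∃ (ℓ k : ℕ), ℓ + k = 2 * m ∧
  ∃ (p : Fin ℓ → (Fin m ⊕ Fin n)) (idx : Fin k → Fin ℓ)
    (u : Fin k → (Fin m ⊕ Fin n)) (c : Fin (n - m) → Fin n) (a : Fin (n - m) → Fin m),
    Function.Injective p ∧ Function.Injective u ∧ Function.Injective c ∧
    (∀ t s, p t ≠ u s) ∧
    (∀ t s, p t ≠ Sum.inr (c s)) ∧
    (∀ t s, u t ≠ Sum.inr (c s)) ∧
    (∀ x : Fin m ⊕ Fin n, (∃ t, p t = x) ∨ (∃ t, u t = x) ∨ (∃ s, Sum.inr (c s) = x)) ∧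
    StrictMono idx ∧
    (∀ t, 0 < (idx t : ℕ) ∧ (idx t : ℕ) + 1 < ℓ) ∧
    (∀ t : Fin k, ∀ h : (t : ℕ) + 1 < k,
      ((idx t : ℕ) + 1) % 2 ≠ ((idx ⟨(t : ℕ) + 1, h⟩ : ℕ) + 1) % 2) ∧
    (∀ h : 0 < k, 1 % 2 ≠ ((idx ⟨0, h⟩ : ℕ) + 1) % 2) ∧
    (∀ h : 0 < k, ((idx ⟨k - 1, by omega⟩ : ℕ) + 1) % 2 ≠ ℓ % 2) ∧
    (∀ s, (∃ t, p t = Sum.inl (a s)) ∧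
      ∀ t, Sum.inl (a s) ≠ u t ∧ p (idx t) ≠ Sum.inl (a s)) ∧
    (∀ x y : Fin m ⊕ Fin n, (bigraph P).Adj x y ↔
      ((∃ t : Fin ℓ, ∃ h : (t : ℕ) + 1 < ℓ,
          (x = p t ∧ y = p ⟨(t : ℕ) + 1, h⟩) ∨ (y = p t ∧ x = p ⟨(t : ℕ) + 1, h⟩)) ∨
       (∃ t : Fin k, (x = u t ∧ y = p (idx t)) ∨ (y = u t ∧ x = p (idx t))) ∨
       (∃ s : Fin (n - m), (x = Sum.inr (c s) ∧ y = Sum.inl (a s)) ∨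
          (y = Sum.inr (c s) ∧ x = Sum.inl (a s)))))

/-- The path `p` is a spine of the caterpillar `G`: it is an induced path of `G`, and every vertex
off the path has exactly one neighbour, which lies on the path. -/
structure IsSpine {V : Type*} {ℓ : ℕ} (G : SimpleGraph V) (p : Fin ℓ → V) : Prop where
  injective : Function.Injective p
  adj_iff : ∀ s t : Fin ℓ, G.Adj (p s) (p t) ↔ (s : ℕ) + 1 = t ∨ (t : ℕ) + 1 = s
  pendant : ∀ x, (∀ t, p t ≠ x) → ∃ t, ∀ y, G.Adj x y ↔ y = p t

theorem bigraph_adj_inl_inr {m n : ℕ} (P : Matrix (Fin m) (Fin n) ℝ) (i : Fin m) (j : Fin n) :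
    (bigraph P).Adj (Sum.inl i) (Sum.inr j) ↔ P i j = 1 := by
  simp [bigraph]

theorem bigraph_adj_iff_fromBlocks {m n : ℕ} {P A : Matrix (Fin m) (Fin n) ℝ}
    (hA : HasPattern A P) (x y : Fin m ⊕ Fin n) :
    (bigraph P).Adj x y ↔ Matrix.fromBlocks 0 A Aᵀ 0 x y ≠ 0 := by
  rcases x with i | j <;> rcases y with i' | j'
  · simp [bigraph]
  · rw [bigraph_adj_inl_inr, Matrix.fromBlocks_apply₁₂, hA]
  · rw [SimpleGraph.adj_comm, bigraph_adj_inl_inr, Matrix.fromBlocks_apply₂₁,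
      Matrix.transpose_apply, hA]
  · simp [bigraph]

/-- The path of a Fiedler graph is a spine of it. -/
theorem IsFiedlerBigraph.exists_spine {m n : ℕ} {P : Matrix (Fin m) (Fin n) ℝ}
    (h : IsFiedlerBigraph P) :
    ∃ (ℓ : ℕ) (p : Fin ℓ → Fin m ⊕ Fin n), IsSpine (bigraph P) p := by
  obtain ⟨ℓ, k, -, p, idx, u, c, a, hp, hu, hc, hpu, hpc, huc, hcov, -, -, -, -, -, ha, hadj⟩ := h
  refine ⟨ℓ, p, hp, fun s t => ?_, fun x hx => ?_⟩
  · rw [hadj]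
    constructor
    · rintro (⟨r, hr, ⟨h₁, h₂⟩ | ⟨h₁, h₂⟩⟩ | ⟨r, ⟨h₁, -⟩ | ⟨h₁, -⟩⟩ | ⟨r, ⟨h₁, -⟩ | ⟨h₁, -⟩⟩)
      · left; rw [hp h₁, hp h₂]
      · right; rw [hp h₁, hp h₂]
      · exact absurd h₁ (hpu _ _)
      · exact absurd h₁ (hpu _ _)
      · exact absurd h₁ (hpc _ _)
      · exact absurd h₁ (hpc _ _)
    · rintro (hst | hst)
      · exact Or.inl ⟨s, hst ▸ t.2, Or.inl ⟨rfl, congrArg p (Fin.ext hst.symm)⟩⟩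
      · exact Or.inl ⟨t, hst ▸ s.2, Or.inr ⟨rfl, congrArg p (Fin.ext hst.symm)⟩⟩
  · rcases hcov x with ⟨t, rfl⟩ | ⟨t, rfl⟩ | ⟨s, rfl⟩
    · exact absurd rfl (hx t)
    · refine ⟨idx t, fun y => ?_⟩
      rw [hadj]
      constructor
      · rintro (⟨r, hr, ⟨h₁, -⟩ | ⟨-, h₁⟩⟩ | ⟨r, ⟨h₁, h₂⟩ | ⟨-, h₁⟩⟩ | ⟨r, ⟨h₁, -⟩ | ⟨-, h₁⟩⟩)
        · exact absurd h₁.symm (hpu _ _)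
        · exact absurd h₁.symm (hpu _ _)
        · rw [h₂, hu h₁]
        · exact absurd h₁.symm (hpu _ _)
        · exact absurd h₁ (huc _ _)
        · exact absurd h₁.symm ((ha r).2 t).1
      · rintro rfl
        exact Or.inr (Or.inl ⟨t, Or.inl ⟨rfl, rfl⟩⟩)
    · obtain ⟨⟨t, ht⟩, -⟩ := ha s
      refine ⟨t, fun y => ?_⟩
      rw [hadj]
      constructor
      · rintro (⟨r, hr, ⟨h₁, -⟩ | ⟨-, h₁⟩⟩ | ⟨r, ⟨h₁, -⟩ | ⟨-, h₁⟩⟩ | ⟨r, ⟨h₁, h₂⟩ | ⟨-, h₁⟩⟩)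
        · exact absurd h₁.symm (hpc _ _)
        · exact absurd h₁.symm (hpc _ _)
        · exact absurd h₁.symm (huc _ _)
        · exact absurd h₁.symm (hpc _ _)
        · rw [h₂, ht, hc (Sum.inr_injective h₁)]
        · exact absurd h₁ Sum.inr_ne_inl
      · rintro rfl
        exact Or.inr (Or.inr ⟨s, Or.inl ⟨rfl, ht⟩⟩)

/-- Let `W` be a weighted adjacency matrix of a caterpillar and let `d` have no zero entry.
A solution of `W z = diag(d) z` that vanishes at the first vertex of the spine is zero. -/
theorem IsSpine.eq_zero_of_apply_zero {V : Type*} [Fintype V] {ℓ : ℕ} {G : SimpleGraph V}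
    {p : Fin ℓ → V} (hp : IsSpine G p) {W : Matrix V V ℝ} (hW : ∀ x y, G.Adj x y ↔ W x y ≠ 0)
    {d z : V → ℝ} (hd : ∀ v, d v ≠ 0) (hz : ∀ v, (W *ᵥ z) v = d v * z v)
    (h0 : ∀ t : Fin ℓ, (t : ℕ) = 0 → z (p t) = 0) : z = 0 := by
  classical
  have sum_one (v w : V) (hne : ∀ y, y ≠ w → W v y * z y = 0) :
      W v w * z w = d v * z v := by
    rw [← hz, Matrix.mulVec, dotProduct,
      Finset.sum_eq_single w (fun y _ hy => hne y hy) (fun h => absurd (Finset.mem_univ _) h)]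
  have off (x : V) (t : Fin ℓ) (hx : ∀ y, G.Adj x y ↔ y = p t) (ht : z (p t) = 0) : z x = 0 := by
    have := sum_one x (p t) fun y hy => by
      rw [not_not.1 ((hW x y).not.1 (mt (hx y).1 hy)), zero_mul]
    rw [ht, mul_zero] at this
    exact (mul_eq_zero.1 this.symm).resolve_left (hd x)
  have on_path : ∀ N : ℕ, ∀ t : Fin ℓ, (t : ℕ) = N → z (p t) = 0 := by
    intro N
    induction N using Nat.strong_induction_on with
    | _ N ih =>
      intro t ht
      rcases Nat.eq_zero_or_pos N with rfl | hN
      · exact h0 t ht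
      let s : Fin ℓ := ⟨N - 1, by omega⟩
      have hs : (s : ℕ) = N - 1 := rfl
      have hsz : z (p s) = 0 := ih _ (by omega) s hs
      have hst : G.Adj (p s) (p t) := (hp.adj_iff s t).2 (Or.inl (by omega))
      have := sum_one (p s) (p t) fun y hy => by
        by_cases hadj : G.Adj (p s) y
        · refine mul_eq_zero_of_right _ ?_
          by_cases hy' : ∃ r, p r = y
          · obtain ⟨r, rfl⟩ := hy'
            have hrt : (r : ℕ) ≠ t := fun h => hy (congrArg p (Fin.ext h))
            have := (hp.adj_iff s r).1 hadj
            exact ih r (by omega) r rfl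
          · obtain ⟨r, hr⟩ := hp.pendant y (not_exists.1 hy')
            exact off y r hr ((hr _).1 hadj.symm ▸ hsz)
        · rw [not_not.1 ((hW _ _).not.1 hadj), zero_mul]
      rw [hsz, mul_zero] at this
      exact (mul_eq_zero.1 this).resolve_left ((hW _ _).1 hst)
  funext x
  by_cases hx : ∃ t, p t = x
  · obtain ⟨t, rfl⟩ := hx
    exact on_path t t rfl
  · obtain ⟨t, ht⟩ := hp.pendant x (not_exists.1 hx)
    exact off x t ht (on_path t t rfl)

/-- A matrix whose bigraph is a caterpillar with a matching covering the rows has linearly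
independent rows. -/
theorem IsSpine.eq_zero_of_transpose_mulVec_eq_zero {m n ℓ : ℕ} {P A : Matrix (Fin m) (Fin n) ℝ}
    (hA : HasPattern A P) {p : Fin ℓ → Fin m ⊕ Fin n} (hp : IsSpine (bigraph P) p)
    {f : Fin m → Fin n} (hf : Function.Injective f) (hPf : ∀ i, P i (f i) = 1)
    {x : Fin m → ℝ} (hx : Aᵀ *ᵥ x = 0) : x = 0 := by
  have adj_f (i : Fin m) : (bigraph P).Adj (Sum.inl i) (Sum.inr (f i)) :=
    (bigraph_adj_inl_inr P _ _).2 (hPf i)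
  have step (i : Fin m) (hi : x i ≠ 0) : ∃ i' ≠ i, x i' ≠ 0 ∧
      ∃ t s t' : Fin ℓ, p t = Sum.inr (f i) ∧ p s = Sum.inl i' ∧ p t' = Sum.inr (f i') ∧
        ((s : ℕ) + 1 = t ∨ (t : ℕ) + 1 = s) := by
    have other (i : Fin m) (hi : x i ≠ 0) : ∃ i' ≠ i, x i' ≠ 0 ∧ A i' (f i) ≠ 0 := by
      by_contra! hcon
      have hsum : ∑ i', A i' (f i) * x i' = 0 := congrFun hx (f i)
      rw [Finset.sum_eq_single i (fun i' _ hi' => ?_)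
        (fun h => absurd (Finset.mem_univ _) h)] at hsum
      · exact (mul_ne_zero ((hA _ _).2 (hPf i)) hi) hsum
      · by_cases h : x i' = 0
        · rw [h, mul_zero]
        · rw [hcon i' hi' h, zero_mul]
    have col_mem (i : Fin m) (hi : x i ≠ 0) : ∃ t, p t = Sum.inr (f i) := by
      obtain ⟨i', hne, -, hi'⟩ := other i hi
      by_contra hcon
      obtain ⟨t, ht⟩ := hp.pendant _ (not_exists.1 hcon)
      have h₁ := (ht _).1 (adj_f i).symm
      have h₂ := (ht _).1 ((bigraph_adj_inl_inr P i' (f i)).2 ((hA _ _).1 hi')).symm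
      exact hne (Sum.inl_injective (h₂.trans h₁.symm))
    obtain ⟨i', hne, hi', hA'⟩ := other i hi
    have hadj := (bigraph_adj_inl_inr P i' (f i)).2 ((hA _ _).1 hA')
    obtain ⟨t, ht⟩ := col_mem i hi
    obtain ⟨t', ht'⟩ := col_mem i' hi'
    obtain ⟨s, hs⟩ : ∃ s, p s = Sum.inl i' := by
      by_contra hcon
      obtain ⟨r, hr⟩ := hp.pendant _ (not_exists.1 hcon)
      have h₁ := (hr _).1 (adj_f i')
      have h₂ := (hr _).1 hadj
      exact hne (hf (Sum.inr_injective (h₁.trans h₂.symm)))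
    refine ⟨i', hne, hi', t, s, t', ht, hs, ht', ?_⟩
    rwa [← hs, ← ht, hp.adj_iff] at hadj
  have adj_pos {i : Fin m} {s t : Fin ℓ} (hs : p s = Sum.inl i) (ht : p t = Sum.inr (f i)) :
      (s : ℕ) + 1 = t ∨ (t : ℕ) + 1 = s := by
    rw [← hp.adj_iff, hs, ht]
    exact adj_f i
  have pos_ne {i i' : Fin m} (hne : i' ≠ i) {t t' : Fin ℓ} (ht : p t = Sum.inr (f i))
      (ht' : p t' = Sum.inr (f i')) : (t' : ℕ) ≠ t := fun h =>
    hne (hf (Sum.inr_injective (ht'.symm.trans ((congrArg p (Fin.ext h)).trans ht))))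
  have pos_ne' {i i' : Fin m} (hne : i' ≠ i) {s s' : Fin ℓ} (hs : p s = Sum.inl i)
      (hs' : p s' = Sum.inl i') : (s' : ℕ) ≠ s := fun h =>
    hne (Sum.inl_injective (hs'.symm.trans ((congrArg p (Fin.ext h)).trans hs)))
  have right : ∀ (N : ℕ) (i : Fin m) (s t : Fin ℓ), x i ≠ 0 → p s = Sum.inl i →
      p t = Sum.inr (f i) → (s : ℕ) + 1 = t → ℓ - s ≤ N → False := by
    intro N
    induction N with
    | zero => intro i s t _ _ _ _ hN; omega
    | succ N ih =>
      intro i s t hi hs ht hst hN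
      obtain ⟨i', hne, hi', t₀, s', t', ht₀, hs', ht', hadj⟩ := step i hi
      obtain rfl := hp.injective (ht₀.trans ht.symm)
      have h₁ := pos_ne hne ht ht'
      have h₂ := pos_ne' hne hs hs'
      have h₃ := adj_pos hs' ht'
      exact ih i' s' t' hi' hs' ht' (by omega) (by omega)
  have left : ∀ (N : ℕ) (i : Fin m) (s t : Fin ℓ), x i ≠ 0 → p s = Sum.inl i →
      p t = Sum.inr (f i) → (t : ℕ) + 1 = s → (s : ℕ) ≤ N → False := by
    intro N
    induction N with
    | zero => intro i s t _ _ _ _ hN; omega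
    | succ N ih =>
      intro i s t hi hs ht hst hN
      obtain ⟨i', hne, hi', t₀, s', t', ht₀, hs', ht', hadj⟩ := step i hi
      obtain rfl := hp.injective (ht₀.trans ht.symm)
      have h₁ := pos_ne hne ht ht'
      have h₂ := pos_ne' hne hs hs'
      have h₃ := adj_pos hs' ht'
      exact ih i' s' t' hi' hs' ht' (by omega) (by omega)
  funext i
  by_contra hi
  obtain ⟨i', -, hi', -, s, t, -, hs, ht, -⟩ := step i hi
  rcases adj_pos hs ht with h | h
  · exact right _ i' s t hi' hs ht h le_rfl
  · exact left _ i' s t hi' hs ht h le_rfl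

/-- If each eigenspace of a real symmetric matrix meets the kernel of some linear functional
trivially, then its eigenvalues are distinct. -/
theorem Matrix.IsHermitian.eigenvalues_injective_of_functional {ι : Type*} [Fintype ι]
    [DecidableEq ι] {H : Matrix ι ι ℝ} (hH : H.IsHermitian)
    (h : ∀ μ : ℝ, ∃ φ : (ι → ℝ) →ₗ[ℝ] ℝ, ∀ v, H *ᵥ v = μ • v → φ v = 0 → v = 0) :
    Function.Injective hH.eigenvalues := by
  intro i j hij
  by_contra hne
  obtain ⟨φ, hφ⟩ := h (hH.eigenvalues i)
  let b : ι → ι → ℝ := fun i => hH.eigenvectorBasis i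
  have hbi : H *ᵥ b i = hH.eigenvalues i • b i := hH.mulVec_eigenvectorBasis i
  have hbj : H *ᵥ b j = hH.eigenvalues i • b j := hij ▸ hH.mulVec_eigenvectorBasis j
  have hcomb : φ (b j) • b i + (-φ (b i)) • b j = 0 := by
    refine hφ _ ?_ ?_
    · rw [Matrix.mulVec_add, Matrix.mulVec_smul, Matrix.mulVec_smul, hbi, hbj, smul_add,
        smul_comm, smul_comm (-φ (b i))]
    · simp [mul_comm]
  have hli : LinearIndependent ℝ ![hH.eigenvectorBasis i, hH.eigenvectorBasis j] := by
    have hinj : Function.Injective ![i, j] := by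
      simpa [Function.Injective, Fin.forall_fin_two, eq_comm] using hne
    have hcomp : hH.eigenvectorBasis ∘ ![i, j] =
        ![hH.eigenvectorBasis i, hH.eigenvectorBasis j] := by
      ext r : 1
      fin_cases r <;> rfl
    exact hcomp ▸ hH.eigenvectorBasis.orthonormal.linearIndependent.comp _ hinj
  have hzero := LinearIndependent.pair_iff.1 hli (φ (b j)) (-φ (b i)) (by
    ext r
    exact congrFun hcomb r)
  have hbz : b i = 0 := hφ _ hbi (neg_eq_zero.1 hzero.2)
  refine hH.eigenvectorBasis.toBasis.ne_zero i ?_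
  ext r
  simpa using congrFun hbz r

/-- If `P` is an `m × n` pattern with `m ≤ n` and term-rank `m` whose bigraph is an
`m × n` Fiedler graph, then every matrix `A` with pattern `P` has `m` distinct singular
values: `A * Aᵀ` has `m` distinct eigenvalues. -/
theorem fiedler_distinct_singular_values {m n : ℕ} (hmn : m ≤ n)
    (P : Matrix (Fin m) (Fin n) ℝ) (hP : IsPattern P)
    (htr : ∃ f : Fin m → Fin n, Function.Injective f ∧ ∀ i, P i (f i) = 1)
    (hfied : IsFiedlerBigraph P)
    (A : Matrix (Fin m) (Fin n) ℝ) (hA : HasPattern A P) :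
    ∃ f : Fin m → ℝ, Function.Injective f ∧
      (A * Aᵀ).charpoly = ∏ i, (X - C (f i)) := by
  obtain ⟨g, hg, hPg⟩ := htr
  obtain ⟨ℓ, p, hp⟩ := hfied.exists_spine
  have hH : (A * Aᵀ).IsHermitian := by
    simpa using Matrix.isHermitian_mul_conjTranspose_self A
  refine ⟨hH.eigenvalues, hH.eigenvalues_injective_of_functional fun μ => ?_, ?_⟩
  · rcases eq_or_ne μ 0 with rfl | hμ
    · refine ⟨0, fun v hv _ => hp.eq_zero_of_transpose_mulVec_eq_zero hA hg hPg ?_⟩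
      have : v ⬝ᵥ (A * Aᵀ) *ᵥ v = 0 := by rw [hv, zero_smul, dotProduct_zero]
      rw [← Matrix.mulVec_mulVec, Matrix.dotProduct_mulVec, ← Matrix.mulVec_transpose] at this
      exact dotProduct_self_eq_zero.1 this
    · let L : (Fin m → ℝ) →ₗ[ℝ] (Fin m ⊕ Fin n → ℝ) :=
        { toFun := fun v => Sum.elim v (Aᵀ *ᵥ v)
          map_add' := fun v w => by ext (i | j) <;> simp [Matrix.mulVec_add]
          map_smul' := fun r v => by ext (i | j) <;> simp [Matrix.mulVec_smul] }
      have key (v : Fin m → ℝ) (hv : (A * Aᵀ) *ᵥ v = μ • v)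
          (h0 : ∀ t : Fin ℓ, (t : ℕ) = 0 → L v (p t) = 0) : v = 0 := by
        have hLv : L v = 0 := by
          refine hp.eq_zero_of_apply_zero (bigraph_adj_iff_fromBlocks hA)
            (d := Sum.elim (fun _ => μ) (fun _ => 1)) ?_ ?_ h0
          · rintro (i | j)
            · exact hμ
            · exact one_ne_zero
          · rintro (i | j)
            · simpa [L, Matrix.fromBlocks_mulVec] using congrFun hv i
            · simp [L, Matrix.fromBlocks_mulVec]
        funext i
        exact congrFun hLv (Sum.inl i)
      rcases Nat.eq_zero_or_pos ℓ with rfl | hℓ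
      · exact ⟨0, fun v hv _ => key v hv fun t => t.elim0⟩
      · refine ⟨LinearMap.proj (p ⟨0, hℓ⟩) ∘ₗ L, fun v hv h0 => key v hv fun t ht => ?_⟩
        obtain rfl : t = ⟨0, hℓ⟩ := Fin.ext ht
        exact h0
  · simpa using hH.charpoly_eq
end

section
/- Let P be an m×n pattern with m ≤ n. Then every real matrix with pattern P has rank m if and only if the rows and columns of P can be permuted to obtain a pattern of the block form [S | T], where S is an m×m pattern that is upper triangular with all diagonal entries equal to 1 (i.e., s_{ii} = 1 for all i and s_{ij} = 0 whenever i > j). -/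
open Matrix Polynomial

/-- A zero-one vector that does not have exactly one `1` on `R` can be reweighted, without
changing its support, so that its sum over `R` vanishes. -/
theorem exists_same_support_sum_eq_zero {α : Type*} [DecidableEq α] (p : α → ℝ)
    (hp : ∀ i, p i = 0 ∨ p i = 1) (R : Finset α)
    (h : ¬ ∃ r ∈ R, p r = 1 ∧ ∀ s ∈ R, s ≠ r → p s = 0) :
    ∃ a : α → ℝ, (∀ i, a i ≠ 0 ↔ p i = 1) ∧ ∑ i ∈ R, a i = 0 := by
  have hp' : ∀ i, p i ≠ 0 ↔ p i = 1 := fun i => by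
    rcases hp i with h | h <;> simp [h]
  by_cases h0 : ∃ r ∈ R, p r = 1
  · obtain ⟨r, hr, hr1⟩ := h0
    obtain ⟨s, hs, hsr, hs0⟩ : ∃ s ∈ R, s ≠ r ∧ p s ≠ 0 := by
      by_contra! hc
      exact h ⟨r, hr, hr1, hc⟩
    have hpos : 0 < ∑ i ∈ R.erase r, p i := by
      refine Finset.sum_pos' (fun i _ => ?_) ⟨s, Finset.mem_erase.2 ⟨hsr, hs⟩, ?_⟩
      · rcases hp i with h | h <;> simp [h]
      · rw [(hp' s).1 hs0]; exact one_pos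
    refine ⟨Function.update p r (-∑ i ∈ R.erase r, p i), fun i => ?_, ?_⟩
    · by_cases hi : i = r
      · subst hi; simp [hr1, hpos.ne']
      · simpa [hi] using hp' i
    · rw [← Finset.add_sum_erase R _ hr, Function.update_self,
        Finset.sum_congr rfl fun i hi => Function.update_of_ne (Finset.ne_of_mem_erase hi) _ _,
        neg_add_cancel]
  · push Not at h0
    exact ⟨p, hp', Finset.sum_eq_zero fun i hi => (hp i).resolve_right (h0 i hi)⟩

/-- A matrix has rank equal to its number of rows iff its rows are linearly independent. -/
theorem rank_eq_card_iff_linearIndependent_row {α β : Type*} [Fintype α] [Fintype β]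
    (A : Matrix α β ℝ) : A.rank = Fintype.card α ↔ LinearIndependent ℝ A.row := by
  rw [linearIndependent_iff_card_eq_finrank_span, Matrix.rank_eq_finrank_span_row, eq_comm]
  rfl

/-- If every matrix with pattern `P` has full row rank, then for each nonempty set of rows some
column of `P` has exactly one `1` in these rows. -/
theorem exists_unique_one_of_forall_rank {α β : Type*} [Fintype α] [DecidableEq α] [Fintype β]
    (P : Matrix α β ℝ) (hP : IsPattern P)
    (h : ∀ A : Matrix α β ℝ, HasPattern A P → A.rank = Fintype.card α)
    (R : Finset α) (hR : R.Nonempty) :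
    ∃ j, ∃ r ∈ R, P r j = 1 ∧ ∀ s ∈ R, s ≠ r → P s j = 0 := by
  by_contra hc
  rw [not_exists] at hc
  choose a ha hsum using fun j =>
    exists_same_support_sum_eq_zero (fun i => P i j) (fun i => hP i j) R (hc j)
  have hli := (rank_eq_card_iff_linearIndependent_row (Matrix.of fun i j => a j i)).1
    (h _ fun i j => ha j i)
  obtain ⟨r, hr⟩ := hR
  refine one_ne_zero (linearIndependent_iff'.1 hli R (fun _ => (1 : ℝ)) ?_ r hr)
  ext j
  simpa [Finset.sum_apply] using hsum j

/-- Greedy selection of rows and columns forming a triangular array. -/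
theorem exists_greedy_selection {α β : Type*} [Fintype α] [DecidableEq α]
    (P : Matrix α β ℝ)
    (h : ∀ R : Finset α, R.Nonempty →
      ∃ j, ∃ r ∈ R, P r j = 1 ∧ ∀ s ∈ R, s ≠ r → P s j = 0)
    (k : ℕ) (hk : k ≤ Fintype.card α) :
    ∃ (ρ : Fin k → α) (c : Fin k → β), Function.Injective ρ ∧ (∀ i, P (ρ i) (c i) = 1) ∧
      ∀ i s, (∀ j ≤ i, s ≠ ρ j) → P s (c i) = 0 := by
  induction k with
  | zero => exact ⟨Fin.elim0, Fin.elim0, fun i => i.elim0, fun i => i.elim0, fun i => i.elim0⟩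
  | succ k ih =>
    obtain ⟨ρ, c, hρ, h1, h0⟩ := ih (by omega)
    have hR : (Finset.univ.image ρ)ᶜ.Nonempty := by
      rw [← Finset.card_pos, Finset.card_compl]
      have := Finset.card_image_le (s := Finset.univ) (f := ρ)
      simp only [Finset.card_univ, Fintype.card_fin] at this
      omega
    obtain ⟨j, r, hr, hrj, hs⟩ := h _ hR
    have hr' : ∀ i, ρ i ≠ r := by simpa using hr
    refine ⟨Fin.snoc ρ r, Fin.snoc c j, ?_, ?_, ?_⟩
    · rw [Fin.snoc_injective_iff]
      exact ⟨hρ, by simpa using hr'⟩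
    · intro i
      induction i using Fin.lastCases with
      | last => simpa using hrj
      | cast i => simpa using h1 i
    · intro i s hsi
      induction i using Fin.lastCases with
      | last =>
        rw [Fin.snoc_last]
        refine hs s ?_ (by simpa using hsi (Fin.last k) le_rfl)
        simp only [Finset.mem_compl, Finset.mem_image, Finset.mem_univ, true_and, not_exists]
        intro i hi
        exact hsi i.castSucc (Fin.le_last _) (by simp [hi])
      | cast i =>
        rw [Fin.snoc_castSucc]
        refine h0 i s fun l hl => ?_
        simpa using hsi l.castSucc (by simpa using hl)

/-- An injection from `Fin m` to `Fin n` extends along `Fin.castLE` to a permutation. -/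
theorem exists_perm_comp_castLE {m n : ℕ} (hmn : m ≤ n) (c : Fin m → Fin n)
    (hc : Function.Injective c) :
    ∃ γ : Equiv.Perm (Fin n), ∀ i, γ (Fin.castLE hmn i) = c i := by
  let e := (Equiv.ofInjective _ (Fin.castLE_injective hmn)).symm.trans (Equiv.ofInjective c hc)
  refine ⟨e.extendSubtype, fun i => ?_⟩
  rw [Equiv.extendSubtype_apply_of_mem e _ ⟨i, rfl⟩]
  simp only [e, Equiv.trans_apply]
  rw [Equiv.ofInjective_symm_apply]
  rfl

/-- Let `P` be an `m × n` pattern with `m ≤ n`.  Every matrix with pattern `P` has rank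
`m` if and only if the rows and columns of `P` can be permuted so that the resulting
pattern has the block form `[S | T]` where the `m × m` block `S` is upper triangular with
all diagonal entries equal to `1`. -/
theorem requires_full_rank_iff {m n : ℕ} (hmn : m ≤ n)
    (P : Matrix (Fin m) (Fin n) ℝ) (hP : IsPattern P) :
    (∀ A : Matrix (Fin m) (Fin n) ℝ, HasPattern A P → A.rank = m) ↔
      ∃ (ρ : Equiv.Perm (Fin m)) (γ : Equiv.Perm (Fin n)),
        (∀ i : Fin m, P (ρ i) (γ (Fin.castLE hmn i)) = 1) ∧
        (∀ i j : Fin m, (j : ℕ) < (i : ℕ) → P (ρ i) (γ (Fin.castLE hmn j)) = 0) := by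
  constructor
  · intro h
    obtain ⟨ρ, c, hρ, h1, h0⟩ := exists_greedy_selection P
      (exists_unique_one_of_forall_rank P hP (by simpa using h)) m (by simp)
    have hlt : ∀ i j : Fin m, j < i → P (ρ i) (c j) = 0 := fun i j hij =>
      h0 j _ fun l hl heq => (hl.trans_lt hij).ne (hρ heq).symm
    have hc : Function.Injective c := by
      have hne : ∀ i j, i < j → c i ≠ c j := fun i j hij heq =>
        one_ne_zero ((h1 j).symm.trans (heq ▸ hlt j i hij))
      intro i j heq
      by_contra hij
      rcases lt_or_gt_of_ne hij with hij | hij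
      exacts [hne i j hij heq, hne j i hij heq.symm]
    obtain ⟨γ, hγ⟩ := exists_perm_comp_castLE hmn c hc
    refine ⟨Equiv.ofBijective ρ (Finite.injective_iff_bijective.1 hρ), γ, fun i => ?_,
      fun i j hij => ?_⟩
    · rw [hγ]; exact h1 i
    · rw [hγ]; exact hlt i j hij
  · rintro ⟨ρ, γ, h1, h0⟩ A hA
    have hdet : (A.submatrix ρ (γ ∘ Fin.castLE hmn)).det ≠ 0 := by
      rw [Matrix.det_of_isUpperTriangular]
      · exact Finset.prod_ne_zero_iff.2 fun i _ => (hA _ _).2 (h1 i)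
      · intro i j hij
        by_contra hne
        have := (hA _ _).1 hne
        rw [Function.comp_apply, h0 i j hij] at this
        exact zero_ne_one this
    refine le_antisymm (by simpa using A.rank_le_card_height) ?_
    have hrank := Matrix.rank_of_isUnit _ ((Matrix.isUnit_iff_isUnit_det _).2 hdet.isUnit)
    rw [Fintype.card_fin] at hrank
    exact hrank.ge.trans (Matrix.rank_submatrix_le _ _ _)
end

section
/- Let A be an m×n real matrix with m ≤ n and let σ be a singular value of A with multiplicity k. Let ℓ < k and let Â be the (m+ℓ)×n real matrix obtained by bordering A below by an arbitrary ℓ×n real matrix U, i.e., Â = [[A],[U]] in block form. Then σ is a singular value of Â with multiplicity at least k − ℓ. -/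
open Matrix Polynomial

/-- The algebraic multiplicity of an eigenvalue of a real symmetric matrix equals its geometric
multiplicity. -/
theorem Matrix.IsSymm.rootMultiplicity_charpoly {α : Type*} [Fintype α] [DecidableEq α]
    {M : Matrix α α ℝ} (hM : M.IsSymm) (μ : ℝ) :
    M.charpoly.rootMultiplicity μ = Module.finrank ℝ (Module.End.eigenspace M.mulVecLin μ) := by
  have hN : (M - μ • (1 : Matrix α α ℝ)).IsSymm := hM.sub (Matrix.isSymm_one.smul μ)
  have hφ : M.mulVecLin - μ • (1 : Module.End ℝ (α → ℝ)) =
      (M - μ • (1 : Matrix α α ℝ)).mulVecLin := by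
    ext; simp
  have hker : LinearMap.ker ((M.mulVecLin - μ • (1 : Module.End ℝ (α → ℝ))) ^ 1) =
      LinearMap.ker ((M.mulVecLin - μ • (1 : Module.End ℝ (α → ℝ))) ^ Nat.succ 1) := by
    have h := Matrix.ker_mulVecLin_transpose_mul_self (M - μ • (1 : Matrix α α ℝ))
    rw [hN.eq, Matrix.mulVecLin_mul] at h
    rw [hφ, pow_one, pow_two]
    exact h.symm
  rw [← Matrix.charpoly_mulVecLin, ← LinearMap.finrank_maxGenEigenspace_eq]
  suffices h : Module.End.maxGenEigenspace M.mulVecLin μ = Module.End.eigenspace M.mulVecLin μ by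
    rw [h]
  refine le_antisymm (fun x hx ↦ ?_) (Module.End.genEigenspace_le_maximal _ _ 1)
  obtain ⟨j, hj⟩ := (Module.End.mem_maxGenEigenspace _ _ _).1 hx
  rw [Module.End.eigenspace_def, ← pow_one (M.mulVecLin - _),
    Module.End.ker_pow_constant hker j, LinearMap.mem_ker, pow_add]
  rw [Module.End.mul_apply, hj, map_zero]

/-- The singular value multiplicity of `A` at `σ` is the dimension of the `σ²`-eigenspace of
`A * Aᵀ`. -/
theorem singValMult_eq_finrank_eigenspace {α β : Type*} [Fintype α] [DecidableEq α] [Fintype β]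
    (A : Matrix α β ℝ) (σ : ℝ) :
    singValMult A σ = Module.finrank ℝ (Module.End.eigenspace (A * Aᵀ).mulVecLin (σ ^ 2)) := by
  have h : (A * Aᵀ).IsSymm := by simp [Matrix.IsSymm, Matrix.transpose_mul]
  rw [singValMult, h.rootMultiplicity_charpoly]

/-- Bordering a matrix below by rows indexed by `γ` lowers the multiplicity of a singular value by
at most the cardinality of `γ`. -/
theorem singValMult_le_singValMult_bordered_add_card {α β γ : Type*} [Fintype α] [DecidableEq α]
    [Fintype β] [Fintype γ] [DecidableEq γ] (A : Matrix α β ℝ) (U : Matrix γ β ℝ) (σ : ℝ) :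
    singValMult A σ ≤
      singValMult (Matrix.of (Sum.elim A U) : Matrix (α ⊕ γ) β ℝ) σ + Fintype.card γ := by
  simp only [singValMult_eq_finrank_eigenspace]
  set E := Module.End.eigenspace (A * Aᵀ).mulVecLin (σ ^ 2)
  set B : Matrix (α ⊕ γ) β ℝ := Matrix.of (Sum.elim A U)
  have hB : B * Bᵀ = Matrix.fromBlocks (A * Aᵀ) (A * Uᵀ) (U * Aᵀ) (U * Uᵀ) := by
    change Matrix.fromRows A U * (Matrix.fromRows A U)ᵀ = _
    rw [Matrix.transpose_fromRows, Matrix.fromRows_mul_fromCols]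
  let f : E →ₗ[ℝ] (γ → ℝ) := (U * Aᵀ).mulVecLin.domRestrict E
  let extend : (α → ℝ) →ₗ[ℝ] (α ⊕ γ → ℝ) :=
    (LinearEquiv.sumArrowLequivProdArrow α γ ℝ ℝ).symm.toLinearMap ∘ₗ LinearMap.inl ℝ _ _
  have extend_apply (x : α → ℝ) : extend x = Sum.elim x 0 := by
    ext (i | i) <;> rfl
  have extend_mem (x : LinearMap.ker f) :
      extend (x : E) ∈ Module.End.eigenspace (B * Bᵀ).mulVecLin (σ ^ 2) := by
    have hx : (A * Aᵀ) *ᵥ ((x : E) : α → ℝ) = σ ^ 2 • ((x : E) : α → ℝ) :=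
      Module.End.mem_eigenspace_iff.1 (x : E).2
    have hx' : (U * Aᵀ) *ᵥ ((x : E) : α → ℝ) = 0 := x.2
    rw [Module.End.mem_eigenspace_iff, extend_apply, hB, Matrix.mulVecLin_apply,
      Matrix.fromBlocks_mulVec]
    simp only [Sum.elim_comp_inl, Sum.elim_comp_inr, Matrix.mulVec_zero, add_zero, hx, hx']
    ext (i | i) <;> simp
  have extend_injective : Function.Injective extend := fun x y h ↦ by
    rw [extend_apply, extend_apply] at h
    exact funext fun i ↦ congrFun h (Sum.inl i)
  let g : LinearMap.ker f →ₗ[ℝ] Module.End.eigenspace (B * Bᵀ).mulVecLin (σ ^ 2) :=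
    (extend ∘ₗ E.subtype ∘ₗ (LinearMap.ker f).subtype).codRestrict _ extend_mem
  have hg : Function.Injective g := fun x y h ↦
    Subtype.ext (Subtype.ext (extend_injective (congrArg Subtype.val h)))
  have hle := LinearMap.finrank_le_finrank_of_injective hg
  have hrange := (LinearMap.range f).finrank_le
  rw [Module.finrank_fintype_fun_eq_card] at hrange
  have := f.finrank_range_add_finrank_ker
  lia

/-- **Bordering.**  Let `A` be an `m × n` matrix (`m ≤ n`) and `σ` a singular value of `A`
of multiplicity `k`.  If `l < k` and `Â` is obtained from `A` by bordering it below by an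
arbitrary `l × n` matrix `U`, then `σ` is a singular value of `Â` of multiplicity at
least `k - l`. -/
theorem bordering_multiplicity {m n l : ℕ} (hmn : m ≤ n)
    (A : Matrix (Fin m) (Fin n) ℝ) (σ : ℝ) (hσ : 0 ≤ σ) (k : ℕ)
    (hk : singValMult A σ = k) (hk1 : 1 ≤ k) (hl : l < k)
    (U : Matrix (Fin l) (Fin n) ℝ) :
    k - l ≤ singValMult (Matrix.of (Sum.elim A U) : Matrix (Fin m ⊕ Fin l) (Fin n) ℝ) σ := by
  have h := singValMult_le_singValMult_bordered_add_card A U σ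
  rw [hk, Fintype.card_fin] at h
  lia
end

section
/- Let Q be an n×n real matrix with the SSVP whose rows are mutually orthogonal and all of Euclidean length ℓ, and let P be the pattern of Q. Let k < n, p ≥ k, and let S be any superpattern of the (n+k)×(n+p) pattern [[P, O],[O, O]] (block form, with P in the top-left and all other blocks zero, where the bottom-right zero block is k×p). Then there exists a real matrix A with pattern S such that the multiplicity of ℓ as a singular value of A is at least n − k. -/
open Matrix Polynomial

section

variable {m q : Type*} [Fintype m] [DecidableEq m]

lemma transpose_mul_self_of_mul_transpose_self {Q : Matrix m m ℝ} {c : ℝ} (hc : c ≠ 0)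
    (h : Q * Qᵀ = c • (1 : Matrix m m ℝ)) : Qᵀ * Q = c • (1 : Matrix m m ℝ) := by
  have h1 : Q * (c⁻¹ • Qᵀ) = 1 := by
    rw [mul_smul_comm, h, smul_smul, inv_mul_cancel₀ hc, one_smul]
  have h2 := mul_eq_one_comm.mp h1
  rw [smul_mul_assoc] at h2
  rw [← h2, smul_smul, mul_inv_cancel₀ hc, one_smul]

/-- For a scaled orthogonal matrix `Q` with the SSVP, the tangent vectors `K * Q`, `K` skew, of the
orthogonal group attain all prescribed values on the zero positions of `Q`. -/
lemma SSVP.exists_sub_transpose_mul_eq {Q : Matrix m m ℝ} (hQ : SSVP Q) {c : ℝ} (hc : c ≠ 0)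
    (h : Q * Qᵀ = c • (1 : Matrix m m ℝ)) (W : Matrix m m ℝ) :
    ∃ N : Matrix m m ℝ, ∀ i j, Q i j = 0 → ((N - Nᵀ) * Q) i j = W i j := by
  let f : Matrix m m ℝ × Matrix m m ℝ →ₗ[ℝ] Matrix m m ℝ :=
    { toFun := fun p => (p.1 - p.1ᵀ) * Q + Matrix.of fun i j => Q i j * p.2 i j
      map_add' := by
        intro x y
        ext i j
        simp [sub_mul, add_mul, mul_add]
        ring
      map_smul' := by
        intro r x
        ext i j
        simp [sub_mul]
        ring }
  have hf : f.range = ⊤ := by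
    by_contra hne
    obtain ⟨φ, hφ0, hφ⟩ := Submodule.exists_le_ker_of_lt_top _ (lt_top_iff_ne_top.2 hne)
    have hφf : ∀ N J, φ (f (N, J)) = 0 := fun N J => hφ ⟨(N, J), rfl⟩
    let X : Matrix m m ℝ := Matrix.of fun i j => φ (Matrix.single i j 1)
    have hφX : ∀ M, φ M = (Xᵀ * M).trace := by
      intro M
      conv_lhs => rw [Matrix.matrix_eq_sum_single M]
      simp only [map_sum, Matrix.trace, Matrix.diag, Matrix.mul_apply, Matrix.transpose_apply]
      rw [Finset.sum_comm]
      refine Finset.sum_congr rfl fun j _ => Finset.sum_congr rfl fun i _ => ?_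
      have : Matrix.single i j (M i j) = M i j • Matrix.single i j (1 : ℝ) := by simp
      rw [this, map_smul, smul_eq_mul, mul_comm]
      rfl
    have hsymm : Q * Xᵀ = X * Qᵀ := by
      refine Matrix.ext_iff_trace_mul_left.mpr fun N => ?_
      have h1 := hφf N 0
      have h2 : f (N, 0) = (N - Nᵀ) * Q := by
        ext i j
        simp [f]
      rw [h2, hφX, sub_mul, mul_sub, Matrix.trace_sub, sub_eq_zero, ← Matrix.trace_transpose
        (Xᵀ * (Nᵀ * Q))] at h1
      simp only [Matrix.transpose_mul, Matrix.transpose_transpose] at h1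
      rw [Matrix.trace_mul_comm, Matrix.mul_assoc] at h1
      rw [h1, Matrix.trace_mul_comm, ← Matrix.mul_assoc, Matrix.trace_mul_comm]
    have hQQ := transpose_mul_self_of_mul_transpose_self hc h
    have hX : X = 0 := by
      refine hQ X ?_ ?_ ?_
      · have h3 : Qᵀ * (Q * Xᵀ) * Q = Qᵀ * (X * Qᵀ) * Q := by rw [hsymm]
        have h4 : c • (Xᵀ * Q) = c • (Qᵀ * X) := by
          calc c • (Xᵀ * Q) = (Qᵀ * Q) * (Xᵀ * Q) := by rw [hQQ]; simp
            _ = Qᵀ * (Q * Xᵀ) * Q := by simp only [Matrix.mul_assoc]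
            _ = Qᵀ * X * (Qᵀ * Q) := by rw [h3]; simp only [Matrix.mul_assoc]
            _ = c • (Qᵀ * X) := by rw [hQQ]; simp
        rw [Matrix.IsSymm, Matrix.transpose_mul, Matrix.transpose_transpose]
        exact smul_right_injective _ hc h4
      · rw [Matrix.IsSymm, Matrix.transpose_mul, Matrix.transpose_transpose, hsymm]
      · intro i j
        have h5 := hφf 0 (Matrix.single i j 1)
        have h6 : f (0, Matrix.single i j 1) = Q i j • Matrix.single i j (1 : ℝ) := by
          ext a b
          by_cases hab : i = a ∧ j = b
          · obtain ⟨rfl, rfl⟩ := hab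
            simp [f]
          · simp [f, Matrix.single_apply_of_ne _ _ _ _ _ hab]
        rwa [h6, map_smul] at h5
    refine hφ0 (LinearMap.ext fun M => ?_)
    rw [hφX, hX]
    simp
  obtain ⟨⟨N, J⟩, hNJ⟩ := LinearMap.range_eq_top.mp hf W
  refine ⟨N, fun i j hij => ?_⟩
  rw [← hNJ]
  simp [f, hij]

/-- For a scaled orthogonal matrix `Q` with the SSVP, the derivative of
`(B, L) ↦ B * Bᵀ + (L - Lᵀ)` at `Q`, together with the restriction of `B` to the zero positions of
`Q`, is surjective. -/
lemma SSVP.exists_derivative_eq {Q : Matrix m m ℝ} (hQ : SSVP Q) {c : ℝ} (hc : c ≠ 0)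
    (h : Q * Qᵀ = c • (1 : Matrix m m ℝ)) (M W : Matrix m m ℝ) :
    ∃ H L : Matrix m m ℝ, Q * Hᵀ + H * Qᵀ + (L - Lᵀ) = M ∧ ∀ i j, Q i j = 0 → H i j = W i j := by
  obtain ⟨N, hN⟩ := hQ.exists_sub_transpose_mul_eq hc h (W - (4 * c)⁻¹ • ((M + Mᵀ) * Q))
  refine ⟨(4 * c)⁻¹ • ((M + Mᵀ) * Q) + (N - Nᵀ) * Q, (2 : ℝ)⁻¹ • M, ?_, fun i j hij => ?_⟩
  · have hcancel : ∀ Y : Matrix m m ℝ, Q * (Qᵀ * Y) = c • Y := fun Y => by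
      rw [← Matrix.mul_assoc, h, smul_mul_assoc, one_mul]
    simp only [Matrix.transpose_add, Matrix.transpose_sub, Matrix.transpose_smul,
      Matrix.transpose_mul, Matrix.transpose_transpose, mul_add, add_mul, mul_sub, sub_mul,
      mul_smul_comm, smul_mul_assoc, Matrix.mul_assoc, hcancel, h, mul_one]
    ext i j
    simp
    field_simp
    ring
  · rw [Matrix.add_apply, hN i j hij, Matrix.sub_apply]
    ring

open scoped Matrix.Norms.Operator in
/-- A scaled orthogonal matrix with the SSVP can be perturbed so that its zero entries attain
prescribed small values and its rows become orthonormal (up to scale) after bordering by a small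
multiple of `C`. -/
lemma SSVP.exists_perturbation [Fintype q] {Q : Matrix m m ℝ} (hQ : SSVP Q) {c : ℝ} (hc : c ≠ 0)
    (h : Q * Qᵀ = c • (1 : Matrix m m ℝ)) (T : Matrix m m ℝ) (C : Matrix m q ℝ) :
    ∃ (B : Matrix m m ℝ) (ε : ℝ), ε ≠ 0 ∧ B * Bᵀ + (ε • C) * (ε • C)ᵀ = c • (1 : Matrix m m ℝ) ∧
      (∀ i j, Q i j ≠ 0 → B i j ≠ 0) ∧ ∀ i j, Q i j = 0 → B i j = ε * T i j := by
  let Z := {z : m × m // Q z.1 z.2 = 0}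
  let tr : Matrix m m ℝ →L[ℝ] Matrix m m ℝ :=
    (Matrix.transposeLinearEquiv m m ℝ ℝ).toLinearMap.toContinuousLinearMap
  let res : Matrix m m ℝ →L[ℝ] (Z → ℝ) := LinearMap.toContinuousLinearMap
    { toFun := fun M z => M z.1.1 z.1.2
      map_add' := fun _ _ => rfl
      map_smul' := fun _ _ => rfl }
  let fst : Matrix m m ℝ × Matrix m m ℝ →L[ℝ] Matrix m m ℝ :=
    ContinuousLinearMap.fst ℝ (Matrix m m ℝ) (Matrix m m ℝ)
  let snd : Matrix m m ℝ × Matrix m m ℝ →L[ℝ] Matrix m m ℝ :=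
    ContinuousLinearMap.snd ℝ (Matrix m m ℝ) (Matrix m m ℝ)
  let F : Matrix m m ℝ × Matrix m m ℝ → Matrix m m ℝ × (Z → ℝ) := fun x =>
    (fst x * (tr ∘L fst) x + (snd - tr ∘L snd) x, (res ∘L fst) x)
  obtain ⟨F', hF, hF'⟩ : ∃ F' : Matrix m m ℝ × Matrix m m ℝ →L[ℝ] Matrix m m ℝ × (Z → ℝ),
      HasStrictFDerivAt F F' (Q, 0) ∧ ∀ H L, F' (H, L) = (Q * Hᵀ + H * Qᵀ + (L - Lᵀ), fun z => H z.1.1 z.1.2) :=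
    ⟨_, ((fst.hasStrictFDerivAt.fun_mul' (tr ∘L fst).hasStrictFDerivAt).fun_add
      (snd - tr ∘L snd).hasStrictFDerivAt).prodMk (res ∘L fst).hasStrictFDerivAt,
      fun H L => rfl⟩
  have hsurj : F'.range = ⊤ := by
    refine LinearMap.range_eq_top.mpr fun ⟨M, z⟩ => ?_
    obtain ⟨H, L, h1, h2⟩ := hQ.exists_derivative_eq hc h M
      (Matrix.of fun i j => if hz : Q i j = 0 then z ⟨(i, j), hz⟩ else 0)
    refine ⟨(H, L), (hF' _ _).trans (Prod.ext h1 ?_)⟩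
    funext ⟨⟨i, j⟩, hij⟩
    exact (h2 i j hij).trans (dif_pos hij)
  have hmap := hF.map_nhds_eq_of_surj hsurj
  let U : Set (Matrix m m ℝ × Matrix m m ℝ) := {x | ∀ i j, Q i j ≠ 0 → x.1 i j ≠ 0}
  have hU : U ∈ nhds (Q, 0) := by
    have : ∀ i j, ∀ᶠ x : Matrix m m ℝ × Matrix m m ℝ in nhds (Q, 0), Q i j ≠ 0 → x.1 i j ≠ 0 := by
      intro i j
      by_cases hij : Q i j = 0
      · simp [hij]
      · have hcont : Continuous fun x : Matrix m m ℝ × Matrix m m ℝ => x.1 i j :=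
          (continuous_apply_apply i j).comp continuous_fst
        filter_upwards [hcont.continuousAt.eventually_ne hij] with x hx _ using hx
    exact Filter.eventually_all.mpr fun i => Filter.eventually_all.mpr (this i)
  have himg := hmap ▸ Filter.image_mem_map (m := F) hU
  let γ : ℝ → Matrix m m ℝ × (Z → ℝ) := fun ε =>
    (c • (1 : Matrix m m ℝ) - (ε ^ 2) • (C * Cᵀ), fun z => ε * T z.1.1 z.1.2)
  have hγ : Continuous γ := by
    fun_prop
  have hγ0 : γ 0 = F (Q, 0) := by
    refine Prod.ext ?_ ?_
    · change c • (1 : Matrix m m ℝ) - ((0 : ℝ) ^ 2) • (C * Cᵀ) =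
        Q * Qᵀ + ((0 : Matrix m m ℝ) - (0 : Matrix m m ℝ)ᵀ)
      simp [h]
    · funext ⟨⟨i, j⟩, hij⟩
      exact (zero_mul _).trans hij.symm
  have hev : ∀ᶠ ε in nhds (0 : ℝ), γ ε ∈ Set.image F U :=
    hγ.continuousAt (hγ0 ▸ himg)
  obtain ⟨ε, ⟨⟨B, L⟩, hBL, hFγ⟩, hε⟩ :=
    ((hev.filter_mono nhdsWithin_le_nhds).and (self_mem_nhdsWithin (s := {(0 : ℝ)}ᶜ))).exists
  have h1 : B * Bᵀ + (L - Lᵀ) = c • (1 : Matrix m m ℝ) - (ε ^ 2) • (C * Cᵀ) := congrArg Prod.fst hFγ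
  have h2 : ∀ i j, Q i j = 0 → B i j = ε * T i j := fun i j hij =>
    congrFun (congrArg Prod.snd hFγ) ⟨(i, j), hij⟩
  refine ⟨B, ε, hε, ?_, hBL, h2⟩
  have h3 := congrArg Matrix.transpose h1
  simp only [Matrix.transpose_add, Matrix.transpose_sub, Matrix.transpose_mul,
    Matrix.transpose_transpose, Matrix.transpose_smul, Matrix.transpose_one] at h3
  have h4 : B * Bᵀ = c • (1 : Matrix m m ℝ) - (ε ^ 2) • (C * Cᵀ) := by
    linear_combination (norm := module) (2⁻¹ : ℝ) • h1 + (2⁻¹ : ℝ) • h3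
  rw [h4]
  simp [smul_smul, sq]

/-- If the first rows of a matrix are orthogonal of length `l`, then `l` is a singular value whose
multiplicity is at least the number of these rows minus the number of the others. -/
lemma card_sub_card_le_singValMult {s t : Type*} [Fintype s] [DecidableEq s] [Fintype t]
    (R : Matrix m t ℝ) (E : Matrix s t ℝ) {l : ℝ} (h : R * Rᵀ = l ^ 2 • (1 : Matrix m m ℝ)) :
    Fintype.card m - Fintype.card s ≤ singValMult (Matrix.fromRows R E) l := by
  set A := Matrix.fromRows R E
  let g := Matrix.toLin' (A * Aᵀ)
  let ι : (m → ℝ) →ₗ[ℝ] (m ⊕ s → ℝ) :=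
    { toFun := fun x => Sum.elim x 0
      map_add' := fun x y => by ext (i | i) <;> simp
      map_smul' := fun r x => by ext (i | i) <;> simp }
  have hι : Function.Injective ι := fun x y hxy => by
    funext i
    exact congrFun hxy (Sum.inl i)
  let w := Matrix.toLin' (E * Rᵀ)
  have hle : w.ker.map ι ≤ Module.End.eigenspace g (l ^ 2) := by
    rintro _ ⟨x, hx, rfl⟩
    have hx' : (E * Rᵀ) *ᵥ x = 0 := hx
    rw [Module.End.mem_eigenspace_iff]
    change (A * Aᵀ) *ᵥ Sum.elim x 0 = l ^ 2 • Sum.elim x 0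
    rw [Matrix.transpose_fromRows, Matrix.fromRows_mul_fromCols, Matrix.fromBlocks_mulVec]
    ext (i | i) <;> simp [h, hx', Matrix.smul_mulVec]
  have h1 : Module.finrank ℝ (w.ker.map ι) = Module.finrank ℝ w.ker :=
    (Submodule.equivMapOfInjective ι hι _).finrank_eq.symm
  have h2 := w.finrank_range_add_finrank_ker
  have h3 := Submodule.finrank_le w.range
  rw [Module.finrank_fintype_fun_eq_card] at h2 h3
  have h4 := Submodule.finrank_mono hle
  have h5 := g.finrank_eigenspace_le (l ^ 2)
  have h6 : g.charpoly = (A * Aᵀ).charpoly := Matrix.charpoly_toLin' _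
  rw [singValMult, ← h6]
  omega

end

/-- Let `Q` be an `n × n` matrix with the SSVP whose rows are mutually orthogonal and all
of Euclidean length `l`, and let `P` be the pattern of `Q`.  For `k < n` and `p ≥ k`,
every superpattern `S` of the `(n+k) × (n+p)` block pattern `[[P, O], [O, O]]` allows a
matrix `A` for which `l` is a singular value of multiplicity at least `n - k`. -/
theorem orthogonal_bordering {n k p : ℕ} (hk : k < n) (hp : k ≤ p)
    (Q : Matrix (Fin n) (Fin n) ℝ) (hQ : SSVP Q)
    (l : ℝ) (hl : 0 ≤ l)
    (horth : ∀ i j, i ≠ j → Q i ⬝ᵥ Q j = 0)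
    (hlen : ∀ i, Q i ⬝ᵥ Q i = l ^ 2)
    (P : Matrix (Fin n) (Fin n) ℝ) (hP : IsPattern P) (hQP : HasPattern Q P)
    (S : Matrix (Fin n ⊕ Fin k) (Fin n ⊕ Fin p) ℝ) (hS : IsPattern S)
    (hsup : ∀ i j,
      Matrix.fromBlocks P (0 : Matrix (Fin n) (Fin p) ℝ)
        (0 : Matrix (Fin k) (Fin n) ℝ) (0 : Matrix (Fin k) (Fin p) ℝ) i j = 1 →
      S i j = 1) :
    ∃ A : Matrix (Fin n ⊕ Fin k) (Fin n ⊕ Fin p) ℝ,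
      HasPattern A S ∧ n - k ≤ singValMult A l := by
  have hQQ : Q * Qᵀ = l ^ 2 • (1 : Matrix (Fin n) (Fin n) ℝ) := by
    ext i j
    rcases eq_or_ne i j with rfl | hij
    · simpa [Matrix.mul_apply'] using hlen i
    · simpa [Matrix.mul_apply', hij] using horth i j hij
  have hl2 : l ^ 2 ≠ 0 := by
    intro h0
    have hrow : ∀ i, Q i = 0 := fun i => dotProduct_self_eq_zero.mp ((hlen i).trans h0)
    have hQ0 : Q = 0 := funext hrow
    subst hQ0
    have := hQ (Matrix.of fun _ _ => 1) (by simp [Matrix.IsSymm]) (by simp [Matrix.IsSymm])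
      (by simp)
    exact one_ne_zero (congrFun (congrFun this ⟨0, by omega⟩) ⟨0, by omega⟩)
  obtain ⟨B, ε, hε, horthB, hB1, hB0⟩ :=
    hQ.exists_perturbation hl2 hQQ S.toBlocks₁₁ S.toBlocks₁₂
  have hSpat : ∀ i j, S i j ≠ 0 ↔ S i j = 1 := fun i j => by
    rcases hS i j with h | h <;> simp [h]
  refine ⟨Matrix.fromRows (Matrix.fromCols B (ε • S.toBlocks₁₂))
    (Matrix.fromCols S.toBlocks₂₁ S.toBlocks₂₂), ?_, ?_⟩
  · rintro (i | i) (j | j)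
    · by_cases hij : Q i j = 0
      · simp [hB0 i j hij, hε, Matrix.toBlocks₁₁, hSpat]
      · have : S (Sum.inl i) (Sum.inl j) = 1 := hsup _ _ ((hQP i j).mp hij)
        simp [hB1 i j hij, this]
    · simp [hε, Matrix.toBlocks₁₂, hSpat]
    · simp [Matrix.toBlocks₂₁, hSpat]
    · simp [Matrix.toBlocks₂₂, hSpat]
  · have := card_sub_card_le_singValMult (l := l) (Matrix.fromCols B (ε • S.toBlocks₁₂))
      (Matrix.fromCols S.toBlocks₂₁ S.toBlocks₂₂)
      (by rw [Matrix.transpose_fromCols, Matrix.fromCols_mul_fromRows, horthB])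
    simpa using this
end

section
/- Let n ≥ 2 and let H_n be the n×n full lower Hessenberg pattern, defined by (H_n)_{ij} = 1 if j ≤ i + 1 and (H_n)_{ij} = 0 otherwise. Then every n×n real matrix whose pattern is H_n has the SSVP. -/
open Matrix Polynomial

/-- The `n × n` full lower Hessenberg pattern: `1` in position `(i, j)` iff `j ≤ i + 1`. -/
def fullHessenberg (n : ℕ) : Matrix (Fin n) (Fin n) ℝ :=
  Matrix.of fun i j => if (j : ℕ) ≤ (i : ℕ) + 1 then 1 else 0

/-- For `n ≥ 2`, every matrix whose pattern is the full lower Hessenberg pattern `H_n`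
has the SSVP. -/
theorem hessenberg_SSVP {n : ℕ} (hn : 2 ≤ n)
    (A : Matrix (Fin n) (Fin n) ℝ) (hA : HasPattern A (fullHessenberg n)) :
    SSVP A := by
  have hne (i j : Fin n) (h : (j : ℕ) ≤ i + 1) : A i j ≠ 0 := by
    rw [hA]; simp [fullHessenberg, h]
  have hzero (i j : Fin n) (h : (i : ℕ) + 1 < j) : A i j = 0 := by
    by_contra h0
    rw [← ne_eq, hA] at h0
    simp [fullHessenberg, h.not_ge] at h0
  intro X _ hX hAX
  have hXzero (i j : Fin n) (h : (j : ℕ) ≤ i + 1) : X i j = 0 :=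
    (mul_eq_zero.mp (hAX i j)).resolve_left (hne i j h)
  -- `X * Aᵀ` is strictly upper triangular and symmetric, hence zero; solve its rows left to right.
  ext i k
  induction k using WellFoundedLT.induction with
  | ind k ih =>
    by_cases hk : (k : ℕ) ≤ i + 1
    · exact hXzero i k hk
    obtain ⟨j, hj⟩ : ∃ j : Fin n, (j : ℕ) + 1 = k := ⟨⟨k - 1, by omega⟩, by simp; omega⟩
    have hlower : (X * Aᵀ) j i = 0 := by
      rw [mul_apply]
      refine Finset.sum_eq_zero fun l _ => ?_
      rw [transpose_apply]
      by_cases hl : (l : ℕ) ≤ j + 1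
      · rw [hXzero j l hl, zero_mul]
      · rw [hzero i l (by omega), mul_zero]
    have hupper : (X * Aᵀ) i j = X i k * A j k := by
      rw [mul_apply, Finset.sum_eq_single k, transpose_apply]
      · intro l _ hlk
        rw [transpose_apply]
        rcases lt_or_gt_of_ne hlk with hl | hl
        · rw [ih l hl, Matrix.zero_apply, zero_mul]
        · rw [hzero j l (by omega), mul_zero]
      · simp
    rw [← hX.apply, hlower] at hupper
    exact (mul_eq_zero.mp hupper.symm).resolve_right (hne j k hj.ge)
end
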